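/- arXiv:2307.06603 — 5 statements merged into one kernel-verified Lean document; each statement's English description precedes it below -/
import Mathlib

section
/- Let K be a field of characteristic p > 3 and k a natural number. The following family of homogeneous polynomials of degree k is a K-basis of the degree-k homogeneous component of R = K[b₊, b₋]: the polynomials σ₂^a σ₃^b for all (a,b) ∈ ℕ² with 2a+3b = k; the polynomials σ₂^a σ₃^b · q for all (a,b) with 2a+3b = k-3; the polynomials σ₂^a σ₃^b · b₊ and σ₂^a σ₃^b · b₋ for all (a,b) with 2a+3b = k-1; and the polynomials σ₂^a σ₃^b · (-b₊²+3b₋²) and σ₂^a σ₃^b · (2b₊b₋) for all (a,b) with 2a+3b = k-2. Moreover each σ₂^a σ₃^b is fixed by the S₃-action, each σ₂^a σ₃^b · q satisfies g·(σ₂^aσ₃^b q) = sign(g)·σ₂^aσ₃^b q for every g ∈ S₃, and for each (a,b) the two-dimensional subspaces spanned by {σ₂^aσ₃^b b₊, σ₂^aσ₃^b b₋} and by {σ₂^aσ₃^b(-b₊²+3b₋²), σ₂^aσ₃^b(2b₊b₋)} are S₃-stable, the K-linear maps determined by b₊ ↦ σ₂^aσ₃^b b₊, b₋ ↦ σ₂^aσ₃^b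 b₋ and by b₊ ↦ σ₂^aσ₃^b(-b₊²+3b₋²), b₋ ↦ σ₂^aσ₃^b(2b₊b₋) being S₃-equivariant. -/
open MvPolynomial

noncomputable section

/-- The rescaled Young basis element `b₊` of `𝔥*`, inside `S𝔥* = K[b₊,b₋]`. -/
def bp (K : Type*) [Field K] : MvPolynomial (Fin 2) K := X 0

/-- The rescaled Young basis element `b₋`. -/
def bm (K : Type*) [Field K] : MvPolynomial (Fin 2) K := X 1

/-- The invariant `σ₂ = -(b₊² + 3b₋²)/12`. -/
def sig2 (K : Type*) [Field K] : MvPolynomial (Fin 2) K :=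
  (12 : K)⁻¹ • (-(bp K ^ 2 + 3 * bm K ^ 2))

/-- The invariant `σ₃ = -(b₊³ - 9b₊b₋²)/108`. -/
def sig3 (K : Type*) [Field K] : MvPolynomial (Fin 2) K :=
  (108 : K)⁻¹ • (-(bp K ^ 3 - 9 * bp K * bm K ^ 2))

/-- The Vandermonde polynomial `q = (b₊²b₋ - b₋³)/4`. -/
def qq (K : Type*) [Field K] : MvPolynomial (Fin 2) K :=
  (4 : K)⁻¹ • (bp K ^ 2 * bm K - bm K ^ 3)

/-- Index type for the basis of the degree-`k` component of `S𝔥*`: a `Triv` part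
(`2a+3b = k`), a `Sign` part (`2a+3b+3 = k`) and two `Stand` parts
(`2a+3b+1 = k` and `2a+3b+2 = k`, each two-dimensional). -/
abbrev Idx (k : ℕ) : Type :=
  {ab : ℕ × ℕ // 2 * ab.1 + 3 * ab.2 = k} ⊕
  ({ab : ℕ × ℕ // 2 * ab.1 + 3 * ab.2 + 3 = k} ⊕
  (({ab : ℕ × ℕ // 2 * ab.1 + 3 * ab.2 + 1 = k} × Fin 2) ⊕
   ({ab : ℕ × ℕ // 2 * ab.1 + 3 * ab.2 + 2 = k} × Fin 2)))

/-- The basis family of the degree-`k` component of `S𝔥*`. -/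
def fam (K : Type*) [Field K] (k : ℕ) : Idx k → MvPolynomial (Fin 2) K
  | Sum.inl s => sig2 K ^ s.1.1 * sig3 K ^ s.1.2
  | Sum.inr (Sum.inl s) => sig2 K ^ s.1.1 * sig3 K ^ s.1.2 * qq K
  | Sum.inr (Sum.inr (Sum.inl (s, i))) =>
      sig2 K ^ s.1.1 * sig3 K ^ s.1.2 * ![bp K, bm K] i
  | Sum.inr (Sum.inr (Sum.inr (s, i))) =>
      sig2 K ^ s.1.1 * sig3 K ^ s.1.2 *
        ![-(bp K ^ 2) + 3 * bm K ^ 2, 2 * bp K * bm K] i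

theorem natCast_ne_zero_of_dvd_six_pow {K : Type*} [Field K] {p : ℕ} [CharP K p]
    (hp : p.Prime) (h3 : 3 < p) {n e : ℕ} (hn : n ∣ 6 ^ e) : (n : K) ≠ 0 := by
  rw [Ne, CharP.cast_eq_zero_iff K p]
  intro h
  have h6 : p ∣ 2 * 3 := hp.dvd_of_dvd_pow (h.trans hn)
  rcases hp.dvd_mul.1 h6 with h | h
  · have := Nat.le_of_dvd (by norm_num) h
    omega
  · have := Nat.le_of_dvd (by norm_num) h
    omega

section Family

variable {K : Type*} [Field K]

theorem twelve_mul_sig2 (h : (12 : K) ≠ 0) : 12 * sig2 K = -(bp K ^ 2 + 3 * bm K ^ 2) := by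
  have e : (12 : MvPolynomial (Fin 2) K) = C (12 : K) := (map_ofNat C 12).symm
  rw [sig2, smul_eq_C_mul, ← mul_assoc, e, ← C_mul, mul_inv_cancel₀ h, C_1, one_mul]

theorem mul_sig3 (h : (108 : K) ≠ 0) :
    108 * sig3 K = -(bp K ^ 3 - 9 * bp K * bm K ^ 2) := by
  have e : (108 : MvPolynomial (Fin 2) K) = C (108 : K) := (map_ofNat C 108).symm
  rw [sig3, smul_eq_C_mul, ← mul_assoc, e, ← C_mul, mul_inv_cancel₀ h, C_1, one_mul]

theorem four_mul_qq (h : (4 : K) ≠ 0) : 4 * qq K = bp K ^ 2 * bm K - bm K ^ 3 := by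
  have e : (4 : MvPolynomial (Fin 2) K) = C (4 : K) := (map_ofNat C 4).symm
  rw [qq, smul_eq_C_mul, ← mul_assoc, e, ← C_mul, mul_inv_cancel₀ h, C_1, one_mul]

theorem isHomogeneous_bp : (bp K).IsHomogeneous 1 := isHomogeneous_X _ _

theorem isHomogeneous_bm : (bm K).IsHomogeneous 1 := isHomogeneous_X _ _

theorem isHomogeneous_natCast (n : ℕ) :
    (n : MvPolynomial (Fin 2) K).IsHomogeneous 0 := by
  rw [← map_natCast (C : K →+* MvPolynomial (Fin 2) K)]
  exact isHomogeneous_C _ _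

theorem MvPolynomial.IsHomogeneous.const_smul {σ R : Type*} [CommSemiring R]
    {φ : MvPolynomial σ R} {n : ℕ} (h : φ.IsHomogeneous n) (c : R) :
    (c • φ).IsHomogeneous n :=
  (homogeneousSubmodule σ R n).smul_mem c h

theorem isHomogeneous_sig2 : (sig2 K).IsHomogeneous 2 :=
  (((isHomogeneous_bp.pow 2).add
    ((isHomogeneous_natCast 3).mul (isHomogeneous_bm.pow 2))).neg).const_smul _

theorem isHomogeneous_sig3 : (sig3 K).IsHomogeneous 3 :=
  (((isHomogeneous_bp.pow 3).sub (((isHomogeneous_natCast 9).mul isHomogeneous_bp).mul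
    (isHomogeneous_bm.pow 2))).neg).const_smul _

theorem isHomogeneous_qq : (qq K).IsHomogeneous 3 :=
  (((isHomogeneous_bp.pow 2).mul isHomogeneous_bm).sub (isHomogeneous_bm.pow 3)).const_smul _

theorem isHomogeneous_sig (a b : ℕ) :
    (sig2 K ^ a * sig3 K ^ b).IsHomogeneous (2 * a + 3 * b) :=
  (isHomogeneous_sig2.pow a).mul (isHomogeneous_sig3.pow b)

theorem isHomogeneous_fam (k : ℕ) (x : Idx k) : (fam K k x).IsHomogeneous k := by
  rcases x with ⟨⟨a, b⟩, rfl⟩ | ⟨⟨a, b⟩, rfl⟩ | ⟨⟨⟨a, b⟩, rfl⟩, i⟩ | ⟨⟨⟨a, b⟩, rfl⟩, i⟩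
  · exact isHomogeneous_sig a b
  · exact (isHomogeneous_sig a b).mul isHomogeneous_qq
  · refine (isHomogeneous_sig a b).mul ?_
    fin_cases i
    · exact isHomogeneous_bp
    · exact isHomogeneous_bm
  · refine (isHomogeneous_sig a b).mul ?_
    fin_cases i
    · exact (isHomogeneous_bp.pow 2).neg.add
        ((isHomogeneous_natCast 3).mul (isHomogeneous_bm.pow 2))
    · exact ((isHomogeneous_natCast 2).mul isHomogeneous_bp).mul isHomogeneous_bm

variable (K) in
/-- The span of the family `fam K k`. -/
def famSpan (k : ℕ) : Submodule K (MvPolynomial (Fin 2) K) :=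
  Submodule.span K (Set.range (fam K k))

theorem sig_mem_famSpan {k : ℕ} (a b : ℕ) (h : 2 * a + 3 * b = k) :
    sig2 K ^ a * sig3 K ^ b ∈ famSpan K k :=
  Submodule.subset_span ⟨Sum.inl ⟨(a, b), h⟩, rfl⟩

theorem sig_mul_qq_mem_famSpan {k : ℕ} (a b : ℕ) (h : 2 * a + 3 * b + 3 = k) :
    sig2 K ^ a * sig3 K ^ b * qq K ∈ famSpan K k :=
  Submodule.subset_span ⟨Sum.inr (Sum.inl ⟨(a, b), h⟩), rfl⟩

theorem sig_mul_bp_mem_famSpan {k : ℕ} (a b : ℕ) (h : 2 * a + 3 * b + 1 = k) :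
    sig2 K ^ a * sig3 K ^ b * bp K ∈ famSpan K k :=
  Submodule.subset_span ⟨Sum.inr (Sum.inr (Sum.inl (⟨(a, b), h⟩, 0))), rfl⟩

theorem sig_mul_bm_mem_famSpan {k : ℕ} (a b : ℕ) (h : 2 * a + 3 * b + 1 = k) :
    sig2 K ^ a * sig3 K ^ b * bm K ∈ famSpan K k :=
  Submodule.subset_span ⟨Sum.inr (Sum.inr (Sum.inl (⟨(a, b), h⟩, 1))), rfl⟩

theorem sig_mul_quadratic_mem_famSpan {k : ℕ} (a b : ℕ) (h : 2 * a + 3 * b + 2 = k) :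
    sig2 K ^ a * sig3 K ^ b * (-(bp K ^ 2) + 3 * bm K ^ 2) ∈ famSpan K k :=
  Submodule.subset_span ⟨Sum.inr (Sum.inr (Sum.inr (⟨(a, b), h⟩, 0))), rfl⟩

theorem sig_mul_two_mul_mem_famSpan {k : ℕ} (a b : ℕ) (h : 2 * a + 3 * b + 2 = k) :
    sig2 K ^ a * sig3 K ^ b * (2 * bp K * bm K) ∈ famSpan K k :=
  Submodule.subset_span ⟨Sum.inr (Sum.inr (Sum.inr (⟨(a, b), h⟩, 1))), rfl⟩

theorem intCast_mul_mem {S : Submodule K (MvPolynomial (Fin 2) K)} (n : ℤ)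
    {y : MvPolynomial (Fin 2) K} (hy : y ∈ S) : (n : MvPolynomial (Fin 2) K) * y ∈ S := by
  rw [← zsmul_eq_mul]
  exact S.toAddSubgroup.zsmul_mem hy n

/-- Membership of `y` in a subspace from an integer relation `n * y = c * u + d * v`. -/
theorem mem_of_natCast_mul_eq {S : Submodule K (MvPolynomial (Fin 2) K)} {n : ℕ}
    (hn : (n : K) ≠ 0) (c d : ℤ) {y u v : MvPolynomial (Fin 2) K} (hu : u ∈ S) (hv : v ∈ S)
    (h : (n : MvPolynomial (Fin 2) K) * y = c * u + d * v) : y ∈ S := by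
  rw [← S.smul_mem_iff hn, smul_eq_C_mul, map_natCast, h]
  exact S.add_mem (intCast_mul_mem c hu) (intCast_mul_mem d hv)

theorem mul_mem_famSpan_succ {k : ℕ} {z y : MvPolynomial (Fin 2) K}
    (hz : ∀ x : Idx k, z * fam K k x ∈ famSpan K (k + 1)) (hy : y ∈ famSpan K k) :
    z * y ∈ famSpan K (k + 1) := by
  have : famSpan K k ≤ (famSpan K (k + 1)).comap (LinearMap.mulLeft K z) := by
    refine Submodule.span_le.2 ?_
    rintro _ ⟨x, rfl⟩
    exact hz x
  exact this hy

section Multiplication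

variable (hK : ∀ n e : ℕ, n ∣ 6 ^ e → (n : K) ≠ 0)
include hK

theorem bp_mul_fam_mem (k : ℕ) (x : Idx k) : bp K * fam K k x ∈ famSpan K (k + 1) := by
  have h2 := twelve_mul_sig2 (K := K) (by exact_mod_cast hK 12 2 (by norm_num))
  have h3 := mul_sig3 (K := K) (by exact_mod_cast hK 108 3 (by norm_num))
  have h4 := four_mul_qq (K := K) (by exact_mod_cast hK 4 2 (by norm_num))
  rcases x with ⟨⟨a, b⟩, rfl⟩ | ⟨⟨a, b⟩, rfl⟩ | ⟨⟨⟨a, b⟩, rfl⟩, i⟩ | ⟨⟨⟨a, b⟩, rfl⟩, i⟩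
  · rw [mul_comm (bp K)]
    exact sig_mul_bp_mem_famSpan a b rfl
  · refine mem_of_natCast_mul_eq (hK 12 2 (by norm_num)) (-108) (-12)
      (sig_mul_bm_mem_famSpan a (b + 1) (by ring))
      (sig_mul_two_mul_mem_famSpan (a + 1) b (by ring)) ?_
    simp only [fam]
    push_cast
    linear_combination sig2 K ^ a * sig3 K ^ b * (3 * bp K * h4 + bm K * h3 +
      2 * bp K * bm K * h2)
  · fin_cases i
    · refine mem_of_natCast_mul_eq (hK 2 1 (by norm_num)) (-12) (-1)
        (sig_mem_famSpan (a + 1) b (by ring))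
        (sig_mul_quadratic_mem_famSpan a b (by ring)) ?_
      simp [fam]
      linear_combination sig2 K ^ a * sig3 K ^ b * h2
    · refine mem_of_natCast_mul_eq (hK 2 1 (by norm_num)) 1 0
        (sig_mul_two_mul_mem_famSpan a b (by ring)) (zero_mem _) ?_
      simp [fam]
      ring
  · fin_cases i
    · refine mem_of_natCast_mul_eq (hK 2 1 (by norm_num)) 108 12
        (sig_mem_famSpan a (b + 1) (by ring))
        (sig_mul_bp_mem_famSpan (a + 1) b (by ring)) ?_
      simp [fam]
      linear_combination -sig2 K ^ a * sig3 K ^ b * (h3 + bp K * h2)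
    · refine mem_of_natCast_mul_eq (hK 2 1 (by norm_num)) 12 (-12)
        (sig_mul_qq_mem_famSpan a b (by ring))
        (sig_mul_bm_mem_famSpan (a + 1) b (by ring)) ?_
      simp [fam]
      linear_combination sig2 K ^ a * sig3 K ^ b * (-3 * h4 + bm K * h2)

theorem bm_mul_fam_mem (k : ℕ) (x : Idx k) : bm K * fam K k x ∈ famSpan K (k + 1) := by
  have h2 := twelve_mul_sig2 (K := K) (by exact_mod_cast hK 12 2 (by norm_num))
  have h3 := mul_sig3 (K := K) (by exact_mod_cast hK 108 3 (by norm_num))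
  have h4 := four_mul_qq (K := K) (by exact_mod_cast hK 4 2 (by norm_num))
  rcases x with ⟨⟨a, b⟩, rfl⟩ | ⟨⟨a, b⟩, rfl⟩ | ⟨⟨⟨a, b⟩, rfl⟩, i⟩ | ⟨⟨⟨a, b⟩, rfl⟩, i⟩
  · rw [mul_comm (bm K)]
    exact sig_mul_bm_mem_famSpan a b rfl
  · refine mem_of_natCast_mul_eq (hK 36 2 (by norm_num)) 108 12
      (sig_mul_bp_mem_famSpan a (b + 1) (by ring))
      (sig_mul_quadratic_mem_famSpan (a + 1) b (by ring)) ?_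
    simp only [fam]
    push_cast
    linear_combination sig2 K ^ a * sig3 K ^ b * (9 * bm K * h4 - bp K * h3 -
      (-(bp K ^ 2) + 3 * bm K ^ 2) * h2)
  · fin_cases i
    · refine mem_of_natCast_mul_eq (hK 2 1 (by norm_num)) 1 0
        (sig_mul_two_mul_mem_famSpan a b (by ring)) (zero_mem _) ?_
      simp [fam]
      ring
    · refine mem_of_natCast_mul_eq (hK 6 1 (by norm_num)) (-12) 1
        (sig_mem_famSpan (a + 1) b (by ring))
        (sig_mul_quadratic_mem_famSpan a b (by ring)) ?_
      simp [fam]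
      linear_combination sig2 K ^ a * sig3 K ^ b * h2
  · fin_cases i
    · refine mem_of_natCast_mul_eq (hK 2 1 (by norm_num)) (-12) (-12)
        (sig_mul_qq_mem_famSpan a b (by ring))
        (sig_mul_bm_mem_famSpan (a + 1) b (by ring)) ?_
      simp [fam]
      linear_combination sig2 K ^ a * sig3 K ^ b * (3 * h4 + bm K * h2)
    · refine mem_of_natCast_mul_eq (hK 6 1 (by norm_num)) 108 (-12)
        (sig_mem_famSpan a (b + 1) (by ring))
        (sig_mul_bp_mem_famSpan (a + 1) b (by ring)) ?_
      simp [fam]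
      linear_combination sig2 K ^ a * sig3 K ^ b * (-h3 + bp K * h2)

theorem bp_pow_mul_bm_pow_mem_famSpan (i j : ℕ) :
    bp K ^ i * bm K ^ j ∈ famSpan K (i + j) := by
  induction i with
  | zero =>
    induction j with
    | zero => simpa using sig_mem_famSpan (K := K) (k := 0) 0 0 rfl
    | succ j ih =>
      have h := mul_mem_famSpan_succ (bm_mul_fam_mem hK _) ih
      rwa [mul_left_comm, ← pow_succ'] at h
  | succ i ih =>
    have h := mul_mem_famSpan_succ (bp_mul_fam_mem hK _) ih
    rwa [← mul_assoc, ← pow_succ', add_right_comm] at h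

theorem famSpan_eq_homogeneousSubmodule (k : ℕ) :
    famSpan K k = homogeneousSubmodule (Fin 2) K k := by
  refine le_antisymm (Submodule.span_le.2 ?_) fun φ hφ => ?_
  · rintro _ ⟨x, rfl⟩
    exact isHomogeneous_fam k x
  · rw [φ.as_sum]
    refine Submodule.sum_mem _ fun d hd => ?_
    have hdeg : d 0 + d 1 = k := by
      have h := hφ (mem_support_iff.1 hd)
      rw [Finsupp.weight_apply, Finsupp.sum_fintype _ _ (by simp)] at h
      simpa [Fin.sum_univ_two] using h
    have hm : monomial d (coeff d φ) = coeff d φ • (bp K ^ d 0 * bm K ^ d 1) := by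
      rw [monomial_eq, Finsupp.prod_fintype _ _ (by simp), Fin.prod_univ_two, smul_eq_C_mul]
      rfl
    rw [hm, ← hdeg]
    exact Submodule.smul_mem _ _ (bp_pow_mul_bm_pow_mem_famSpan hK _ _)

end Multiplication

/-- An injection from the index type in degree `k` to the monomials of degree `k`. -/
def Idx.toFin (k : ℕ) : Idx k → Fin (k + 1)
  | Sum.inl s => ⟨3 * s.1.2, by have := s.2; omega⟩
  | Sum.inr (Sum.inl s) => ⟨3 * s.1.2, by have := s.2; omega⟩
  | Sum.inr (Sum.inr (Sum.inl (s, i))) =>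
      ⟨if i = 0 then 3 * s.1.2 + 1 else if s.1.1 = 0 then 3 * s.1.2 else 3 * s.1.2 + 2, by
        have := s.2
        split_ifs <;> omega⟩
  | Sum.inr (Sum.inr (Sum.inr (s, i))) =>
      ⟨if i = 0 then 3 * s.1.2 + 1 else 3 * s.1.2 + 2, by
        have := s.2
        split_ifs <;> omega⟩

theorem Idx.toFin_injective (k : ℕ) : Function.Injective (Idx.toFin k) := by
  rintro (⟨⟨a, b⟩, h⟩ | ⟨⟨a, b⟩, h⟩ | ⟨⟨⟨a, b⟩, h⟩, i⟩ | ⟨⟨⟨a, b⟩, h⟩, i⟩)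
    (⟨⟨a', b'⟩, h'⟩ | ⟨⟨a', b'⟩, h'⟩ | ⟨⟨⟨a', b'⟩, h'⟩, i'⟩ | ⟨⟨⟨a', b'⟩, h'⟩, i'⟩) e <;>
  simp only [Idx.toFin, Fin.mk.injEq, Sum.inl.injEq, Sum.inr.injEq, Prod.mk.injEq,
    Subtype.mk.injEq, reduceCtorEq] at e h h' ⊢ <;>
  (try split_ifs at e) <;> omega

theorem succ_le_finrank_homogeneousSubmodule (k : ℕ)
    [Module.Finite K (homogeneousSubmodule (Fin 2) K k)] :
    k + 1 ≤ Module.finrank K (homogeneousSubmodule (Fin 2) K k) := by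
  let m : Fin (k + 1) → Fin 2 →₀ ℕ := fun i =>
    Finsupp.single 0 (i : ℕ) + Finsupp.single 1 (k - i)
  have hm : Function.Injective m := fun i j h => by
    have := DFunLike.congr_fun h 0
    simpa [m, Fin.ext_iff] using this
  have hli : LinearIndependent K fun i => monomial (m i) (1 : K) := by
    simpa [Function.comp_def] using (basisMonomials (Fin 2) K).linearIndependent.comp m hm
  have hmem : ∀ i, monomial (m i) (1 : K) ∈ homogeneousSubmodule (Fin 2) K k := fun i => by
    refine isHomogeneous_monomial _ ?_
    have := i.2
    simp [m, Finsupp.degree_eq_sum, Fin.sum_univ_two]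
    omega
  have hli' : LinearIndependent K
      fun i => (⟨monomial (m i) 1, hmem i⟩ : homogeneousSubmodule (Fin 2) K k) :=
    LinearIndependent.of_comp (homogeneousSubmodule (Fin 2) K k).subtype hli
  simpa using hli'.fintype_card_le_finrank

theorem linearIndependent_fam (hK : ∀ n e : ℕ, n ∣ 6 ^ e → (n : K) ≠ 0) (k : ℕ) :
    LinearIndependent K (fam K k) := by
  have : Finite (Idx k) := Finite.of_injective _ (Idx.toFin_injective k)
  have := Fintype.ofFinite (Idx k)
  have hcard : Fintype.card (Idx k) ≤ k + 1 := by
    simpa using Fintype.card_le_of_injective _ (Idx.toFin_injective k)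
  have hspan := famSpan_eq_homogeneousSubmodule hK k
  have : Module.Finite K (homogeneousSubmodule (Fin 2) K k) := by
    rw [← hspan]
    exact Module.Finite.span_of_finite K (Set.finite_range _)
  rw [linearIndependent_iff_card_le_finrank_span]
  refine hcard.trans ((succ_le_finrank_homogeneousSubmodule (K := K) k).trans_eq ?_)
  rw [← hspan]
  rfl

theorem map_sig2 {F : MvPolynomial (Fin 2) K ≃ₐ[K] MvPolynomial (Fin 2) K}
    (h : F (bp K) ^ 2 + 3 * F (bm K) ^ 2 = bp K ^ 2 + 3 * bm K ^ 2) :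
    F (sig2 K) = sig2 K := by
  simp only [sig2, map_smul, map_neg, map_add, map_mul, map_pow, map_ofNat, h]

theorem map_sig3 {F : MvPolynomial (Fin 2) K ≃ₐ[K] MvPolynomial (Fin 2) K}
    (h : F (bp K) ^ 3 - 9 * F (bp K) * F (bm K) ^ 2 = bp K ^ 3 - 9 * bp K * bm K ^ 2) :
    F (sig3 K) = sig3 K := by
  simp only [sig3, map_smul, map_neg, map_sub, map_mul, map_pow, map_ofNat, h]

theorem map_qq {F : MvPolynomial (Fin 2) K ≃ₐ[K] MvPolynomial (Fin 2) K}
    (h : F (bp K) ^ 2 * F (bm K) - F (bm K) ^ 3 = -(bp K ^ 2 * bm K - bm K ^ 3)) :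
    F (qq K) = -qq K := by
  simp only [qq, map_smul, map_sub, map_mul, map_pow, h, smul_neg]

end Family

/-- In characteristic `p > 3`, the family `fam K k` is a `K`-basis of the degree-`k`
homogeneous component of `S𝔥* = K[b₊,b₋]`, compatible with the `S₃`-action: the
`σ₂^aσ₃^b` are invariant, the `σ₂^aσ₃^b·q` are sign-semiinvariant, and the two-dimensional
pieces are `S₃`-stable, the indicated maps being `S₃`-equivariant (checked on the
transpositions `(12)`, `(23)`, `(13)`, which generate `S₃`). -/
theorem stmt_1 (K : Type*) [Field K] (p : ℕ) [CharP K p] (hp : p.Prime) (h3 : 3 < p)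
    (k : ℕ)
    (ρ : Equiv.Perm (Fin 3) →* (MvPolynomial (Fin 2) K ≃ₐ[K] MvPolynomial (Fin 2) K))
    (h12p : ρ (Equiv.swap 0 1) (bp K) = bp K)
    (h12m : ρ (Equiv.swap 0 1) (bm K) = -bm K)
    (h23p : ρ (Equiv.swap 1 2) (bp K) = (2 : K)⁻¹ • (-bp K + 3 * bm K))
    (h23m : ρ (Equiv.swap 1 2) (bm K) = (2 : K)⁻¹ • (bp K + bm K))
    (h13p : ρ (Equiv.swap 0 2) (bp K) = (2 : K)⁻¹ • (-bp K - 3 * bm K))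
    (h13m : ρ (Equiv.swap 0 2) (bm K) = (2 : K)⁻¹ • (-bp K + bm K)) :
    -- the family consists of homogeneous polynomials of degree k:
    (∀ x : Idx k, fam K k x ∈ homogeneousSubmodule (Fin 2) K k) ∧
    -- it is a basis of the degree-k component:
    LinearIndependent K (fam K k) ∧
    Submodule.span K (Set.range (fam K k)) = homogeneousSubmodule (Fin 2) K k ∧
    -- each σ₂^a σ₃^b is S₃-invariant:
    (∀ (g : Equiv.Perm (Fin 3)) (a b : ℕ),
      ρ g (sig2 K ^ a * sig3 K ^ b) = sig2 K ^ a * sig3 K ^ b) ∧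
    -- each σ₂^a σ₃^b q is a sign-semiinvariant:
    (∀ (g : Equiv.Perm (Fin 3)) (a b : ℕ),
      ρ g (sig2 K ^ a * sig3 K ^ b * qq K)
        = ((Equiv.Perm.sign g : ℤ) : K) • (sig2 K ^ a * sig3 K ^ b * qq K)) ∧
    -- the span of {σ₂^aσ₃^b b₊, σ₂^aσ₃^b b₋} is S₃-stable, b₊ ↦ σ₂^aσ₃^b b₊,
    -- b₋ ↦ σ₂^aσ₃^b b₋ being S₃-equivariant:
    (∀ (g : Equiv.Perm (Fin 3)) (a b : ℕ),
      ρ g (sig2 K ^ a * sig3 K ^ b * bp K) = sig2 K ^ a * sig3 K ^ b * ρ g (bp K) ∧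
      ρ g (sig2 K ^ a * sig3 K ^ b * bm K) = sig2 K ^ a * sig3 K ^ b * ρ g (bm K)) ∧
    -- the span of {σ₂^aσ₃^b(-b₊²+3b₋²), σ₂^aσ₃^b(2b₊b₋)} is S₃-stable, the map
    -- b₊ ↦ σ₂^aσ₃^b(-b₊²+3b₋²), b₋ ↦ σ₂^aσ₃^b(2b₊b₋) being S₃-equivariant
    -- (spelled out on the generating transpositions):
    (∀ a b : ℕ,
      ρ (Equiv.swap 0 1) (sig2 K ^ a * sig3 K ^ b * (-(bp K ^ 2) + 3 * bm K ^ 2))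
          = sig2 K ^ a * sig3 K ^ b * (-(bp K ^ 2) + 3 * bm K ^ 2) ∧
      ρ (Equiv.swap 0 1) (sig2 K ^ a * sig3 K ^ b * (2 * bp K * bm K))
          = -(sig2 K ^ a * sig3 K ^ b * (2 * bp K * bm K)) ∧
      ρ (Equiv.swap 1 2) (sig2 K ^ a * sig3 K ^ b * (-(bp K ^ 2) + 3 * bm K ^ 2))
          = sig2 K ^ a * sig3 K ^ b *
            ((2 : K)⁻¹ • (-(-(bp K ^ 2) + 3 * bm K ^ 2) + 3 * (2 * bp K * bm K))) ∧
      ρ (Equiv.swap 1 2) (sig2 K ^ a * sig3 K ^ b * (2 * bp K * bm K))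
          = sig2 K ^ a * sig3 K ^ b *
            ((2 : K)⁻¹ • ((-(bp K ^ 2) + 3 * bm K ^ 2) + 2 * bp K * bm K)) ∧
      ρ (Equiv.swap 0 2) (sig2 K ^ a * sig3 K ^ b * (-(bp K ^ 2) + 3 * bm K ^ 2))
          = sig2 K ^ a * sig3 K ^ b *
            ((2 : K)⁻¹ • (-(-(bp K ^ 2) + 3 * bm K ^ 2) - 3 * (2 * bp K * bm K))) ∧
      ρ (Equiv.swap 0 2) (sig2 K ^ a * sig3 K ^ b * (2 * bp K * bm K))
          = sig2 K ^ a * sig3 K ^ b *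
            ((2 : K)⁻¹ • (-(-(bp K ^ 2) + 3 * bm K ^ 2) + 2 * bp K * bm K))) := by
  have hK : ∀ n e : ℕ, n ∣ 6 ^ e → (n : K) ≠ 0 := fun n e hn =>
    natCast_ne_zero_of_dvd_six_pow hp h3 hn
  have hu : 2 * (C (2 : K)⁻¹ : MvPolynomial (Fin 2) K) = 1 := by
    have h2 : (2 : K) ≠ 0 := by exact_mod_cast hK 2 1 (by norm_num)
    have e : (2 : MvPolynomial (Fin 2) K) = C (2 : K) := (map_ofNat C 2).symm
    rw [e, ← C_mul, mul_inv_cancel₀ h2, C_1]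
  simp only [smul_eq_C_mul] at h23p h23m h13p h13m
  simp only [smul_eq_C_mul (a := (2 : K)⁻¹)]
  generalize (C (2 : K)⁻¹ : MvPolynomial (Fin 2) K) = u at hu h23p h23m h13p h13m ⊢
  have hu2 : 4 * u ^ 2 = 1 := by linear_combination (2 * u + 1) * hu
  have hu3 : 8 * u ^ 3 = 1 := by linear_combination (4 * u ^ 2 + 2 * u + 1) * hu
  have hswap : ∀ i j : Fin 3, i ≠ j →
      ρ (Equiv.swap i j) (sig2 K) = sig2 K ∧ ρ (Equiv.swap i j) (sig3 K) = sig3 K ∧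
      ρ (Equiv.swap i j) (qq K) = -qq K := by
    have h01 : ρ (Equiv.swap 0 1) (sig2 K) = sig2 K ∧ ρ (Equiv.swap 0 1) (sig3 K) = sig3 K ∧
        ρ (Equiv.swap 0 1) (qq K) = -qq K := by
      refine ⟨map_sig2 ?_, map_sig3 ?_, map_qq ?_⟩ <;> rw [h12p, h12m] <;> ring
    have h12 : ρ (Equiv.swap 1 2) (sig2 K) = sig2 K ∧ ρ (Equiv.swap 1 2) (sig3 K) = sig3 K ∧
        ρ (Equiv.swap 1 2) (qq K) = -qq K := by
      refine ⟨map_sig2 ?_, map_sig3 ?_, map_qq ?_⟩ <;> rw [h23p, h23m]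
      · linear_combination (bp K ^ 2 + 3 * bm K ^ 2) * hu2
      · linear_combination (bp K ^ 3 - 9 * bp K * bm K ^ 2) * hu3
      · linear_combination -(bp K ^ 2 * bm K - bm K ^ 3) * hu3
    have h02 : ρ (Equiv.swap 0 2) (sig2 K) = sig2 K ∧ ρ (Equiv.swap 0 2) (sig3 K) = sig3 K ∧
        ρ (Equiv.swap 0 2) (qq K) = -qq K := by
      refine ⟨map_sig2 ?_, map_sig3 ?_, map_qq ?_⟩ <;> rw [h13p, h13m]
      · linear_combination (bp K ^ 2 + 3 * bm K ^ 2) * hu2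
      · linear_combination (bp K ^ 3 - 9 * bp K * bm K ^ 2) * hu3
      · linear_combination -(bp K ^ 2 * bm K - bm K ^ 3) * hu3
    intro i j hij
    fin_cases i <;> fin_cases j
    · exact absurd rfl hij
    · exact h01
    · exact h02
    · rw [Equiv.swap_comm]; exact h01
    · exact absurd rfl hij
    · exact h12
    · rw [Equiv.swap_comm]; exact h02
    · rw [Equiv.swap_comm]; exact h12
    · exact absurd rfl hij
  have hperm : ∀ g : Equiv.Perm (Fin 3),
      ρ g (sig2 K) = sig2 K ∧ ρ g (sig3 K) = sig3 K ∧
      ρ g (qq K) = ((Equiv.Perm.sign g : ℤ) : K) • qq K := by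
    intro g
    induction g using Equiv.Perm.swap_induction_on with
    | one => simp
    | swap_mul g i j hij ih =>
      obtain ⟨s2, s3, sq⟩ := hswap i j hij
      obtain ⟨g2, g3, gq⟩ := ih
      refine ⟨?_, ?_, ?_⟩
      · rw [map_mul, AlgEquiv.mul_apply, g2, s2]
      · rw [map_mul, AlgEquiv.mul_apply, g3, s3]
      · rw [map_mul, AlgEquiv.mul_apply, gq, map_smul, sq, Equiv.Perm.sign_mul,
          Equiv.Perm.sign_swap hij]
        simp
  have hsig : ∀ (g : Equiv.Perm (Fin 3)) (a b : ℕ),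
      ρ g (sig2 K ^ a * sig3 K ^ b) = sig2 K ^ a * sig3 K ^ b := fun g a b => by
    rw [map_mul, map_pow, map_pow, (hperm g).1, (hperm g).2.1]
  refine ⟨isHomogeneous_fam k, linearIndependent_fam hK k,
    famSpan_eq_homogeneousSubmodule hK k, hsig, fun g a b => ?_, fun g a b => ?_,
    fun a b => ?_⟩
  · rw [map_mul, hsig, (hperm g).2.2, mul_smul_comm]
  · rw [map_mul _ _ (bp K), map_mul _ _ (bm K), hsig]
    exact ⟨rfl, rfl⟩
  · simp only [map_mul _ (sig2 K ^ a * sig3 K ^ b), hsig]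
    simp only [map_add, map_neg, map_mul, map_pow, map_ofNat, h12p, h12m, h23p, h23m,
      h13p, h13m]
    generalize sig2 K ^ a * sig3 K ^ b = s
    refine ⟨?_, ?_, ?_, ?_, ?_, ?_⟩
    · ring
    · ring
    · linear_combination s * u * (bp K ^ 2 + 6 * bp K * bm K - 3 * bm K ^ 2) * hu
    · linear_combination s * u * (-bp K ^ 2 + 2 * bp K * bm K + 3 * bm K ^ 2) * hu
    · linear_combination s * u * (bp K ^ 2 - 6 * bp K * bm K - 3 * bm K ^ 2) * hu
    · linear_combination s * u * (bp K ^ 2 + 2 * bp K * bm K - 3 * bm K ^ 2) * hu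


end
end

section
/- Let K be a field of characteristic 2 and k a natural number. The following family is a K-basis of the degree-k homogeneous component of R = K[x̄₁, x̄₂]: the polynomials σ̄₂^a σ̄₃^b for all (a,b) ∈ ℕ² with 2a+3b = k; the polynomials σ̄₂^a σ̄₃^{b-1}·(x̄₁³ + x̄₁²x̄₂ + x̄₂³) for all (a,b) with 2a+3b = k and b ≥ 1; the polynomials σ̄₂^a σ̄₃^b·x̄₁ and σ̄₂^a σ̄₃^b·x̄₂ for all (a,b) with 2a+3b = k-1; and the polynomials σ̄₂^a σ̄₃^b·x̄₁² and σ̄₂^a σ̄₃^b·x̄₂² for all (a,b) with 2a+3b = k-2. Moreover each σ̄₂^aσ̄₃^b is S₃-invariant, each two-dimensional span of {σ̄₂^aσ̄₃^b, σ̄₂^aσ̄₃^{b-1}(x̄₁³+x̄₁²x̄₂+x̄₂³)} (for b ≥ 1) is S₃-stable, and the spans of {σ̄₂^aσ̄₃^b x̄₁, σ̄₂^aσ̄₃^b x̄₂} and of {σ̄₂^aσ̄₃^b x̄₁², σ̄₂^aσ̄₃^b x̄₂²} are S₃-stable, with the maps x̄ᵢ ↦ σ̄₂^aσ̄₃^b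 x̄ᵢ and x̄ᵢ ↦ σ̄₂^aσ̄₃^b x̄ᵢ² being S₃-equivariant. -/
open MvPolynomial

noncomputable section

/-- `σ̄₂ = x̄₁² + x̄₁x̄₂ + x̄₂²` in `S𝔥* = K[x̄₁,x̄₂]` (characteristic 2). -/
def t2 (K : Type*) [Field K] : MvPolynomial (Fin 2) K :=
  X 0 ^ 2 + X 0 * X 1 + X 1 ^ 2

/-- `σ̄₃ = x̄₁²x̄₂ + x̄₁x̄₂²`. -/
def t3 (K : Type*) [Field K] : MvPolynomial (Fin 2) K :=
  X 0 ^ 2 * X 1 + X 0 * X 1 ^ 2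

/-- `E = x̄₁³ + x̄₁²x̄₂ + x̄₂³`. -/
def EE (K : Type*) [Field K] : MvPolynomial (Fin 2) K :=
  X 0 ^ 3 + X 0 ^ 2 * X 1 + X 1 ^ 3

/-- Index type for the basis of the degree-`k` component of `S𝔥*` in characteristic 2. -/
abbrev Idx2 (k : ℕ) : Type :=
  {ab : ℕ × ℕ // 2 * ab.1 + 3 * ab.2 = k} ⊕
  ({ab : ℕ × ℕ // 2 * ab.1 + 3 * ab.2 = k ∧ 1 ≤ ab.2} ⊕
  (({ab : ℕ × ℕ // 2 * ab.1 + 3 * ab.2 + 1 = k} × Fin 2) ⊕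
   ({ab : ℕ × ℕ // 2 * ab.1 + 3 * ab.2 + 2 = k} × Fin 2)))

/-- The basis family of the degree-`k` component of `S𝔥*` in characteristic 2. -/
def fam2 (K : Type*) [Field K] (k : ℕ) : Idx2 k → MvPolynomial (Fin 2) K
  | Sum.inl s => t2 K ^ s.1.1 * t3 K ^ s.1.2
  | Sum.inr (Sum.inl s) => t2 K ^ s.1.1 * t3 K ^ (s.1.2 - 1) * EE K
  | Sum.inr (Sum.inr (Sum.inl (s, i))) =>
      t2 K ^ s.1.1 * t3 K ^ s.1.2 * ![(X 0 : MvPolynomial (Fin 2) K), X 1] i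
  | Sum.inr (Sum.inr (Sum.inr (s, i))) =>
      t2 K ^ s.1.1 * t3 K ^ s.1.2 * ![(X 0 : MvPolynomial (Fin 2) K) ^ 2, X 1 ^ 2] i

section Decomposition

variable {K : Type*} [Field K]

lemma t2_isHomogeneous : (t2 K).IsHomogeneous 2 :=
  ((isHomogeneous_X_pow 0 2).add ((isHomogeneous_X K 0).mul (isHomogeneous_X K 1))).add
    (isHomogeneous_X_pow 1 2)

lemma t3_isHomogeneous : (t3 K).IsHomogeneous 3 :=
  ((isHomogeneous_X_pow 0 2).mul (isHomogeneous_X K 1)).add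
    ((isHomogeneous_X K 0).mul (isHomogeneous_X_pow 1 2))

lemma EE_isHomogeneous : (EE K).IsHomogeneous 3 :=
  ((isHomogeneous_X_pow 0 3).add ((isHomogeneous_X_pow 0 2).mul (isHomogeneous_X K 1))).add
    (isHomogeneous_X_pow 1 3)

lemma t2_pow_mul_t3_pow_isHomogeneous (a b : ℕ) :
    (t2 K ^ a * t3 K ^ b).IsHomogeneous (2 * a + 3 * b) :=
  (t2_isHomogeneous.pow a).mul (t3_isHomogeneous.pow b)

lemma fam2_isHomogeneous (k : ℕ) (x : Idx2 k) : (fam2 K k x).IsHomogeneous k := by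
  rcases x with ⟨⟨a, b⟩, h⟩ | ⟨⟨a, b⟩, h, hb⟩ | ⟨⟨⟨a, b⟩, h⟩, i⟩ | ⟨⟨⟨a, b⟩, h⟩, i⟩
  · exact h ▸ t2_pow_mul_t3_pow_isHomogeneous a b
  · have e : 2 * a + 3 * (b - 1) + 3 = k := by simp only at h hb; omega
    exact e ▸ (t2_pow_mul_t3_pow_isHomogeneous a (b - 1)).mul EE_isHomogeneous
  · have hi : (![(X 0 : MvPolynomial (Fin 2) K), X 1] i).IsHomogeneous 1 := by
      fin_cases i <;> exact isHomogeneous_X K _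
    exact h ▸ (t2_pow_mul_t3_pow_isHomogeneous a b).mul hi
  · have hi : (![(X 0 : MvPolynomial (Fin 2) K) ^ 2, X 1 ^ 2] i).IsHomogeneous 2 := by
      fin_cases i <;> exact isHomogeneous_X_pow _ 2
    exact h ▸ (t2_pow_mul_t3_pow_isHomogeneous a b).mul hi

lemma t2_pow_mul_t3_pow_mem_span {a b k : ℕ} (h : 2 * a + 3 * b = k) :
    t2 K ^ a * t3 K ^ b ∈ Submodule.span K (Set.range (fam2 K k)) :=
  Submodule.subset_span ⟨Sum.inl ⟨(a, b), h⟩, rfl⟩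

lemma mul_EE_mem_span {a b k : ℕ} (h : 2 * a + 3 * b + 3 = k) :
    t2 K ^ a * t3 K ^ b * EE K ∈ Submodule.span K (Set.range (fam2 K k)) :=
  Submodule.subset_span ⟨Sum.inr (Sum.inl ⟨(a, b + 1), by simp only; omega⟩), rfl⟩

lemma mul_X_mem_span {a b k : ℕ} (h : 2 * a + 3 * b + 1 = k) (i : Fin 2) :
    t2 K ^ a * t3 K ^ b * X i ∈ Submodule.span K (Set.range (fam2 K k)) :=
  Submodule.subset_span ⟨Sum.inr (Sum.inr (Sum.inl (⟨(a, b), h⟩, i))), by fin_cases i <;> rfl⟩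

lemma mul_X_sq_mem_span {a b k : ℕ} (h : 2 * a + 3 * b + 2 = k) (i : Fin 2) :
    t2 K ^ a * t3 K ^ b * X i ^ 2 ∈ Submodule.span K (Set.range (fam2 K k)) :=
  Submodule.subset_span ⟨Sum.inr (Sum.inr (Sum.inr (⟨(a, b), h⟩, i))), by fin_cases i <;> rfl⟩

lemma EE_mul_X_zero [CharP K 2] : EE K * X 0 = t2 K * X 0 ^ 2 + t3 K * X 1 := by
  simp only [t2, t3, EE]
  linear_combination (-(X 0 ^ 2 * X 1 ^ 2)) * CharTwo.two_eq_zero (R := MvPolynomial (Fin 2) K)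

lemma EE_mul_X_one [CharP K 2] :
    EE K * X 1 = t2 K * X 1 ^ 2 + (t3 K * X 0 + t3 K * X 1) := by
  simp only [t2, t3, EE]
  linear_combination (-(X 0 ^ 2 * X 1 ^ 2 + X 0 * X 1 ^ 3)) *
    CharTwo.two_eq_zero (R := MvPolynomial (Fin 2) K)

lemma X_zero_sq_mul_X_one [CharP K 2] :
    (X 0 ^ 2 * X 1 : MvPolynomial (Fin 2) K) = EE K + (t2 K * X 0 + t2 K * X 1) := by
  simp only [t2, EE]
  linear_combination (-(X 0 ^ 3 + X 0 ^ 2 * X 1 + X 0 * X 1 ^ 2 + X 1 ^ 3)) *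
    CharTwo.two_eq_zero (R := MvPolynomial (Fin 2) K)

lemma fam2_mul_X_mem_span [CharP K 2] (k : ℕ) (x : Idx2 k) (j : Fin 2) :
    fam2 K k x * X j ∈ Submodule.span K (Set.range (fam2 K (k + 1))) := by
  rcases x with ⟨⟨a, b⟩, h⟩ | ⟨⟨a, b⟩, h, hb⟩ | ⟨⟨⟨a, b⟩, h⟩, i⟩ | ⟨⟨⟨a, b⟩, h⟩, i⟩ <;>
    simp only [fam2] at h ⊢
  · exact mul_X_mem_span (by omega) j
  · obtain ⟨b, rfl⟩ : ∃ c, b = c + 1 := ⟨b - 1, by simp only at hb; omega⟩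
    simp only [Nat.add_sub_cancel]
    have q := fun i => mul_X_sq_mem_span (K := K) (a := a + 1) (b := b) (k := k + 1) (by omega) i
    have l := fun i => mul_X_mem_span (K := K) (a := a) (b := b + 1) (k := k + 1) (by omega) i
    fin_cases j <;> simp only [Fin.zero_eta, Fin.mk_one]
    · convert add_mem (q 0) (l 1) using 1
      linear_combination t2 K ^ a * t3 K ^ b * EE_mul_X_zero (K := K)
    · convert add_mem (q 1) (add_mem (l 0) (l 1)) using 1
      linear_combination t2 K ^ a * t3 K ^ b * EE_mul_X_one (K := K)
  · have u := t2_pow_mul_t3_pow_mem_span (K := K) (a := a + 1) (b := b) (k := k + 1) (by omega)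
    have q := fun i => mul_X_sq_mem_span (K := K) (a := a) (b := b) (k := k + 1) (by omega) i
    have m : t2 K ^ a * t3 K ^ b * (X 0 * X 1) ∈
        Submodule.span K (Set.range (fam2 K (k + 1))) := by
      convert sub_mem (sub_mem u (q 0)) (q 1) using 1
      rw [pow_succ]
      nth_rw 3 [t2]
      ring
    fin_cases i <;> fin_cases j <;>
      simp only [Fin.zero_eta, Fin.mk_one, Matrix.cons_val_zero, Matrix.cons_val_one]
    · convert q 0 using 1
      simp [pow_two, mul_assoc]
    · simpa [mul_assoc] using m
    · simpa [mul_assoc, mul_comm (X 1 : MvPolynomial (Fin 2) K)] using m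
    · convert q 1 using 1
      simp [pow_two, mul_assoc]
  · have u := t2_pow_mul_t3_pow_mem_span (K := K) (a := a) (b := b + 1) (k := k + 1) (by omega)
    have e := mul_EE_mem_span (K := K) (a := a) (b := b) (k := k + 1) (by omega)
    have l := fun i => mul_X_mem_span (K := K) (a := a + 1) (b := b) (k := k + 1) (by omega) i
    have m : t2 K ^ a * t3 K ^ b * (X 0 ^ 2 * X 1) ∈
        Submodule.span K (Set.range (fam2 K (k + 1))) := by
      convert add_mem e (add_mem (l 0) (l 1)) using 1
      linear_combination t2 K ^ a * t3 K ^ b * X_zero_sq_mul_X_one (K := K)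
    fin_cases i <;> fin_cases j <;>
      simp only [Fin.zero_eta, Fin.mk_one, Matrix.cons_val_zero, Matrix.cons_val_one]
    · convert sub_mem (l 0) u using 1
      have h0 : (X 0 ^ 2 * X 0 : MvPolynomial (Fin 2) K) = t2 K * X 0 - t3 K := by
        simp only [t2, t3]
        ring
      linear_combination t2 K ^ a * t3 K ^ b * h0
    · simpa [mul_assoc] using m
    · convert sub_mem u m using 1
      have h1 : (X 1 ^ 2 * X 0 : MvPolynomial (Fin 2) K) = t3 K - X 0 ^ 2 * X 1 := by
        simp only [t3]
        ring
      linear_combination t2 K ^ a * t3 K ^ b * h1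
    · convert sub_mem (l 1) u using 1
      have h1 : (X 1 ^ 2 * X 1 : MvPolynomial (Fin 2) K) = t2 K * X 1 - t3 K := by
        simp only [t2, t3]
        ring
      linear_combination t2 K ^ a * t3 K ^ b * h1

lemma homogeneousSubmodule_le_span [CharP K 2] (k : ℕ) :
    homogeneousSubmodule (Fin 2) K k ≤ Submodule.span K (Set.range (fam2 K k)) := by
  induction k with
  | zero =>
    rw [← homogeneousSubmodule_one_pow, pow_zero, Submodule.one_le]
    simpa using t2_pow_mul_t3_pow_mem_span (K := K) (a := 0) (b := 0) rfl
  | succ k ih =>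
    rw [← homogeneousSubmodule_one_pow, pow_succ, homogeneousSubmodule_one_pow,
      homogeneousSubmodule_one_eq_span_X]
    refine (mul_le_mul' ih le_rfl).trans ?_
    rw [Submodule.span_mul_span, Submodule.span_le]
    rintro _ ⟨_, ⟨x, rfl⟩, _, ⟨j, rfl⟩, rfl⟩
    exact fam2_mul_X_mem_span k x j

lemma span_fam2 [CharP K 2] (k : ℕ) :
    Submodule.span K (Set.range (fam2 K k)) = homogeneousSubmodule (Fin 2) K k := by
  refine le_antisymm ?_ (homogeneousSubmodule_le_span k)
  rw [Submodule.span_le]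
  rintro _ ⟨x, rfl⟩
  exact fam2_isHomogeneous k x

/-- The exponent of `x` under the correspondence of `fam2 K k` with monomials `x ^ i * y ^ (k - i)`,
where `t2`, `t3`, `EE`, `X 0`, `X 1`, `X 0 ^ 2`, `X 1 ^ 2` match
`x ^ 2`, `y ^ 3`, `x * y ^ 2`, `x`, `y`, `x * y`, `y ^ 2`. -/
def Idx2.exponent {k : ℕ} : Idx2 k → ℕ
  | Sum.inl s => 2 * s.1.1
  | Sum.inr (Sum.inl s) => 2 * s.1.1 + 1
  | Sum.inr (Sum.inr (Sum.inl (s, i))) => 2 * s.1.1 + (1 - i)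
  | Sum.inr (Sum.inr (Sum.inr (s, i))) => 2 * s.1.1 + (1 - i)

lemma Idx2.exponent_lt {k : ℕ} (x : Idx2 k) : x.exponent < k + 1 := by
  rcases x with ⟨⟨a, b⟩, h⟩ | ⟨⟨a, b⟩, h, hb⟩ | ⟨⟨⟨a, b⟩, h⟩, i⟩ | ⟨⟨⟨a, b⟩, h⟩, i⟩ <;>
    simp only [Idx2.exponent] at * <;> omega

lemma Idx2.exponent_injective {k : ℕ} : Function.Injective (Idx2.exponent (k := k)) := by
  rintro (⟨⟨a, b⟩, h⟩ | ⟨⟨a, b⟩, h, hb⟩ | ⟨⟨⟨a, b⟩, h⟩, i⟩ | ⟨⟨⟨a, b⟩, h⟩, i⟩)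
    (⟨⟨a', b'⟩, h'⟩ | ⟨⟨a', b'⟩, h', hb'⟩ | ⟨⟨⟨a', b'⟩, h'⟩, i'⟩ | ⟨⟨⟨a', b'⟩, h'⟩, i'⟩) e <;>
    simp only [Idx2.exponent, Sum.inl.injEq, Sum.inr.injEq, Subtype.mk.injEq, Prod.mk.injEq,
      Fin.ext_iff, reduceCtorEq] at * <;>
    omega

lemma linearIndependent_X_pow_mul_X_pow (k : ℕ) :
    LinearIndependent K
      (fun i : Fin (k + 1) => (X 0 ^ (i : ℕ) * X 1 ^ (k - i) : MvPolynomial (Fin 2) K)) := by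
  let d : Fin (k + 1) → Fin 2 →₀ ℕ := fun i =>
    Finsupp.single 0 (i : ℕ) + Finsupp.single 1 (k - i)
  have hd : Function.Injective d := fun i j h => by
    simpa [d, Fin.ext_iff] using DFunLike.congr_fun h 0
  have e : (fun i : Fin (k + 1) => (X 0 ^ (i : ℕ) * X 1 ^ (k - i) : MvPolynomial (Fin 2) K)) =
      basisMonomials (Fin 2) K ∘ d := by
    ext1 i
    simp [d, X_pow_eq_monomial, monomial_mul]
  rw [e]
  exact (basisMonomials (Fin 2) K).linearIndependent.comp d hd

lemma linearIndependent_fam2 [CharP K 2] (k : ℕ) : LinearIndependent K (fam2 K k) := by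
  let f : Idx2 k → Fin (k + 1) := fun x => ⟨x.exponent, x.exponent_lt⟩
  have hf : Function.Injective f := fun x y h => Idx2.exponent_injective (congrArg Fin.val h)
  have : Finite (Idx2 k) := Finite.of_injective f hf
  have := Fintype.ofFinite (Idx2 k)
  have : Module.Finite K (Submodule.span K (Set.range (fam2 K k))) :=
    Module.Finite.span_of_finite K (Set.finite_range _)
  rw [linearIndependent_iff_card_le_finrank_span]
  calc Fintype.card (Idx2 k) ≤ Fintype.card (Fin (k + 1)) := Fintype.card_le_of_injective f hf
    _ = _ := (finrank_span_eq_card (linearIndependent_X_pow_mul_X_pow (K := K) k)).symm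
    _ ≤ _ := by
      refine Submodule.finrank_mono ?_
      rw [span_fam2, Submodule.span_le]
      rintro _ ⟨i, rfl⟩
      have h := (isHomogeneous_X_pow (R := K) (0 : Fin 2) i).mul
        (isHomogeneous_X_pow (R := K) (1 : Fin 2) (k - i))
      rwa [Nat.add_sub_of_le (Nat.lt_succ_iff.mp i.2)] at h

lemma perm_fin_three_induction {p : Equiv.Perm (Fin 3) → Prop} (one : p 1)
    (mul : ∀ g h, p g → p h → p (g * h)) (h01 : p (Equiv.swap 0 1)) (h12 : p (Equiv.swap 1 2))
    (g : Equiv.Perm (Fin 3)) : p g := by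
  have h : g = 1 ∨ g = Equiv.swap 0 1 ∨ g = Equiv.swap 1 2 ∨
      g = Equiv.swap 0 1 * Equiv.swap 1 2 ∨ g = Equiv.swap 1 2 * Equiv.swap 0 1 ∨
      g = Equiv.swap 0 1 * Equiv.swap 1 2 * Equiv.swap 0 1 := by
    revert g
    decide
  rcases h with rfl | rfl | rfl | rfl | rfl | rfl <;> simp_all

end Decomposition

/-- In characteristic 2, the family `fam2 K k` is a `K`-basis of the degree-`k`
homogeneous component of `S𝔥* = K[x̄₁,x̄₂]` (with `x̄₃ = x̄₁ + x̄₂` and `S₃` permuting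
`x̄₁,x̄₂,x̄₃`), the `σ̄₂^aσ̄₃^b` are `S₃`-invariant, the spans
`{σ̄₂^aσ̄₃^b, σ̄₂^aσ̄₃^{b-1}E}` are indecomposable `S₃`-stable extensions, and the spans
`{σ̄₂^aσ̄₃^b x̄₁, σ̄₂^aσ̄₃^b x̄₂}` and `{σ̄₂^aσ̄₃^b x̄₁², σ̄₂^aσ̄₃^b x̄₂²}` are `S₃`-stable with
`x̄ᵢ ↦ σ̄₂^aσ̄₃^b x̄ᵢ` and `x̄ᵢ ↦ σ̄₂^aσ̄₃^b x̄ᵢ²` `S₃`-equivariant (squaring is linear in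
characteristic 2). -/
theorem stmt_2 (K : Type*) [Field K] [CharP K 2] (k : ℕ)
    (ρ : Equiv.Perm (Fin 3) →* (MvPolynomial (Fin 2) K ≃ₐ[K] MvPolynomial (Fin 2) K))
    (h12a : ρ (Equiv.swap 0 1) (X 0) = X 1)
    (h12b : ρ (Equiv.swap 0 1) (X 1) = X 0)
    (h23a : ρ (Equiv.swap 1 2) (X 0) = X 0)
    (h23b : ρ (Equiv.swap 1 2) (X 1) = X 0 + X 1)
    (h13a : ρ (Equiv.swap 0 2) (X 0) = X 0 + X 1)
    (h13b : ρ (Equiv.swap 0 2) (X 1) = X 1) :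
    -- the family consists of homogeneous polynomials of degree k:
    (∀ x : Idx2 k, fam2 K k x ∈ homogeneousSubmodule (Fin 2) K k) ∧
    -- it is a basis of the degree-k component:
    LinearIndependent K (fam2 K k) ∧
    Submodule.span K (Set.range (fam2 K k)) = homogeneousSubmodule (Fin 2) K k ∧
    -- each σ̄₂^a σ̄₃^b is S₃-invariant:
    (∀ (g : Equiv.Perm (Fin 3)) (a b : ℕ), ρ g (t2 K ^ a * t3 K ^ b) = t2 K ^ a * t3 K ^ b) ∧
    -- each span {σ̄₂^aσ̄₃^b, σ̄₂^aσ̄₃^{b-1}E} is stable under the generating transpositions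
    -- (written with the exponent shifted by one, i.e. for all b ≥ 0):
    (∀ a b : ℕ,
      ρ (Equiv.swap 0 1) (t2 K ^ a * t3 K ^ b * EE K)
          = t2 K ^ a * t3 K ^ b * EE K + t2 K ^ a * t3 K ^ (b + 1) ∧
      ρ (Equiv.swap 1 2) (t2 K ^ a * t3 K ^ b * EE K)
          = t2 K ^ a * t3 K ^ b * EE K + t2 K ^ a * t3 K ^ (b + 1)) ∧
    -- equivariance of x̄ᵢ ↦ σ̄₂^aσ̄₃^b x̄ᵢ and of x̄ᵢ ↦ σ̄₂^aσ̄₃^b x̄ᵢ²: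
    (∀ (g : Equiv.Perm (Fin 3)) (a b : ℕ),
      (ρ g (t2 K ^ a * t3 K ^ b * X 0) = t2 K ^ a * t3 K ^ b * ρ g (X 0) ∧
       ρ g (t2 K ^ a * t3 K ^ b * X 1) = t2 K ^ a * t3 K ^ b * ρ g (X 1)) ∧
      (ρ g (t2 K ^ a * t3 K ^ b * X 0 ^ 2) = t2 K ^ a * t3 K ^ b * (ρ g (X 0)) ^ 2 ∧
       ρ g (t2 K ^ a * t3 K ^ b * X 1 ^ 2) = t2 K ^ a * t3 K ^ b * (ρ g (X 1)) ^ 2)) := by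
  have two : (2 : MvPolynomial (Fin 2) K) = 0 := CharTwo.two_eq_zero
  have inv (g : Equiv.Perm (Fin 3)) : ρ g (t2 K) = t2 K ∧ ρ g (t3 K) = t3 K := by
    induction g using perm_fin_three_induction with
    | one => simp
    | mul g h hg hh => simp [hg, hh]
    | h01 => constructor <;> simp only [t2, t3, map_add, map_mul, map_pow, h12a, h12b] <;> ring
    | h12 =>
      constructor <;> simp only [t2, t3, map_add, map_mul, map_pow, h23a, h23b]
      · linear_combination (X 0 ^ 2 + X 0 * X 1) * two
      · linear_combination (X 0 ^ 3 + X 0 ^ 2 * X 1) * two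
  have inv' (g : Equiv.Perm (Fin 3)) (a b : ℕ) :
      ρ g (t2 K ^ a * t3 K ^ b) = t2 K ^ a * t3 K ^ b := by
    simp [inv g]
  have hE : ρ (Equiv.swap 0 1) (EE K) = EE K + t3 K := by
    simp only [EE, t3, map_add, map_mul, map_pow, h12a, h12b]
    linear_combination (-X 0 ^ 2 * X 1) * two
  have hE' : ρ (Equiv.swap 1 2) (EE K) = EE K + t3 K := by
    simp only [EE, t3, map_add, map_mul, map_pow, h23a, h23b]
    linear_combination (X 0 ^ 3 + X 0 ^ 2 * X 1 + X 0 * X 1 ^ 2) * two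
  refine ⟨fam2_isHomogeneous k, linearIndependent_fam2 k, span_fam2 k, inv', fun a b => ⟨?_, ?_⟩,
    fun g a b => ⟨⟨?_, ?_⟩, ?_, ?_⟩⟩
  · rw [map_mul, inv', hE]
    ring
  · rw [map_mul, inv', hE']
    ring
  · rw [map_mul, inv']
  · rw [map_mul, inv']
  · rw [map_mul, inv', map_pow]
  · rw [map_mul, inv', map_pow]

end
end

section
/- Let K be a field of characteristic p > 3 and c an integer with p/2 < c < 2p/3; set M := c - (p+1)/2, so that 2M+1 < p. Define v_p := σ₂^{2p-3c} · σ₃ · Σ_{j=0}^{M} binom(M,j) · (2j+1)⁻¹ · (-4σ₂³)^{M-j} · (-27σ₃²)^{j} in R = K[b₊, b₋], where (2j+1)⁻¹ denotes the inverse in K. Then ∂(v_p) = (1/12) · σ₂^{2p-3c-1} · q^{2c-p} · (b₋ - b₊). In particular, since v_p is S₃-invariant, the Dunkl operator value D_{y₁}(v_p) = ∂(v_p) lies in the ideal of R generated by q^{2c-p}. -/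
open MvPolynomial

noncomputable section

/-- The action of the transposition `(12)` on `S𝔥*`: `b₊ ↦ b₊`, `b₋ ↦ -b₋`. -/
def s12 (K : Type*) [Field K] : MvPolynomial (Fin 2) K →ₐ[K] MvPolynomial (Fin 2) K :=
  aeval ![X 0, -X 1]

/-- The action of the transposition `(13)` on `S𝔥*`:
`b₊ ↦ (-b₊-3b₋)/2`, `b₋ ↦ (-b₊+b₋)/2`. -/
def s13 (K : Type*) [Field K] : MvPolynomial (Fin 2) K →ₐ[K] MvPolynomial (Fin 2) K :=
  aeval ![(2 : K)⁻¹ • (-X 0 - 3 * X 1), (2 : K)⁻¹ • (-X 0 + X 1)]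

/-- If `2 (n + 1) + 3 (2 j + 1)` vanishes in `A`, the derivative of `s ^ (n + 1) * t ^ (2 j + 1)`
is a multiple of `2 s D t - 3 t D s`. -/
theorem two_mul_derivation_pow_mul_pow {K A : Type*} [CommRing K] [CommRing A] [Algebra K A]
    (D : Derivation K A A) (s t : A) (n j : ℕ)
    (h : ((2 * (n + 1) + 3 * (2 * j + 1) : ℕ) : A) = 0) :
    2 * D (s ^ (n + 1) * t ^ (2 * j + 1)) =
      ((2 * j + 1 : ℕ) : A) * (s ^ n * t ^ (2 * j)) * (2 * s * D t - 3 * t * D s) := by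
  simp only [Derivation.leibniz, Derivation.leibniz_pow, smul_eq_mul, nsmul_eq_mul,
    Nat.add_sub_cancel]
  push_cast at h ⊢
  linear_combination s ^ n * t ^ (2 * j) * t * D s * h

/-- The inverses occurring in `σ₂`, `σ₃` and `q`, as multiples of a single constant. -/
theorem exists_common_inverse (K : Type*) [Field K] (h2 : (2 : K) ≠ 0) (h3 : (3 : K) ≠ 0) :
    ∃ k : MvPolynomial (Fin 2) K, 108 * k = 1 ∧ C (108 : K)⁻¹ = k ∧ C (12 : K)⁻¹ = 9 * k ∧
      C (4 : K)⁻¹ = 27 * k := by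
  have h108 : (108 : K) ≠ 0 := by
    rw [show (108 : K) = 2 ^ 2 * 3 ^ 3 by norm_num]; positivity
  have h12 : (12 : K) ≠ 0 := by
    rw [show (12 : K) = 2 ^ 2 * 3 by norm_num]; positivity
  have h4 : (4 : K) ≠ 0 := by
    rw [show (4 : K) = 2 ^ 2 by norm_num]; positivity
  have cast (n : ℕ) : (n : MvPolynomial (Fin 2) K) = C (n : K) := by simp
  refine ⟨C (108 : K)⁻¹, ?_, rfl, ?_, ?_⟩
  · have := cast 108
    push_cast at this
    rw [this, ← C_mul, mul_inv_cancel₀ h108, C_1]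
  · have := cast 9
    push_cast at this
    rw [this, ← C_mul]
    congr 1
    field_simp
    norm_num
  · have := cast 27
    push_cast at this
    rw [this, ← C_mul]
    congr 1
    field_simp
    norm_num

theorem neg_four_mul_sig2_cube_add (K : Type*) [Field K] (h2 : (2 : K) ≠ 0) (h3 : (3 : K) ≠ 0) :
    -4 * sig2 K ^ 3 + -27 * sig3 K ^ 2 = qq K ^ 2 := by
  obtain ⟨k, hk, h108, h12, h4⟩ := exists_common_inverse K h2 h3
  simp only [sig2, sig3, qq, smul_eq_C_mul, h108, h12, h4]
  generalize bp K = x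
  generalize bm K = y
  linear_combination (27 * k ^ 2 * (x ^ 3 - 9 * x * y ^ 2) ^ 2
    + 729 * k ^ 2 * (x ^ 2 * y - y ^ 3) ^ 2) * hk

theorem sig2_sig3_wronskian (K : Type*) [Field K] (h2 : (2 : K) ≠ 0) (h3 : (3 : K) ≠ 0)
    (D : Derivation K (MvPolynomial (Fin 2) K) (MvPolynomial (Fin 2) K))
    (hx : D (bp K) = 1) (hy : D (bm K) = 1) :
    2 * sig2 K * D (sig3 K) - 3 * sig3 K * D (sig2 K) =
      2 * (C (12 : K)⁻¹ * qq K * (bm K - bp K)) := by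
  obtain ⟨k, hk, h108, h12, h4⟩ := exists_common_inverse K h2 h3
  have hD (n : ℕ) : D (n : MvPolynomial (Fin 2) K) = 0 := D.map_natCast n
  have hD3 : D 3 = 0 := by exact_mod_cast hD 3
  have hD9 : D 9 = 0 := by exact_mod_cast hD 9
  have hDk : D k = 0 := by rw [← h108]; exact D.map_algebraMap _
  simp only [sig2, sig3, qq, map_neg, map_add, map_sub, Derivation.leibniz,
    Derivation.leibniz_pow, hx, hy, hD3, hD9, hDk, smul_eq_mul, nsmul_eq_mul, smul_eq_C_mul,
    h108, h12, h4]
  generalize bp K = x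
  generalize bm K = y
  push_cast
  ring

/-- For `p/2 < c < 2p/3` and `M = c - (p+1)/2`, the value of the Dunkl operator
`D_{y₁} = ∂` on the invariant vector `v_p` of degree `p`:
`∂(v_p) = (1/12)·σ₂^{2p-3c-1}·q^{2c-p}·(b₋-b₊)`, which lies in the ideal generated by
`q^{2c-p}`; hence `v_p` is singular in `M_{1,c}(Triv)/⟨q^{2c-p}⟩`. -/
theorem stmt_11 (K : Type*) [Field K] (p : ℕ) [CharP K p] (hp : p.Prime) (h3 : 3 < p)
    (c M : ℕ) (hc1 : p < 2 * c) (hc2 : 3 * c < 2 * p) (hM : M = c - (p + 1) / 2)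
    (vp : MvPolynomial (Fin 2) K)
    (hvp : vp = sig2 K ^ (2 * p - 3 * c) * sig3 K *
        ∑ j ∈ Finset.range (M + 1),
          C ((M.choose j : K) * ((2 * j + 1 : ℕ) : K)⁻¹) *
            (-4 * sig2 K ^ 3) ^ (M - j) * (-27 * sig3 K ^ 2) ^ j) :
    pderiv 0 vp + pderiv 1 vp
        = (12 : K)⁻¹ • (sig2 K ^ (2 * p - 3 * c - 1) * qq K ^ (2 * c - p)
            * (bm K - bp K)) ∧
    pderiv 0 vp + pderiv 1 vp ∈ Ideal.span {qq K ^ (2 * c - p)} := by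
  have hne (n : ℕ) (h0 : 0 < n) (hn : n < p) : (n : K) ≠ 0 := fun h =>
    Nat.not_dvd_of_pos_of_lt h0 hn ((CharP.cast_eq_zero_iff K p n).1 h)
  have h2K : (2 : K) ≠ 0 := by exact_mod_cast hne 2 (by norm_num) (by lia)
  have h3K : (3 : K) ≠ 0 := by exact_mod_cast hne 3 (by norm_num) h3
  have hodd : p % 2 = 1 := hp.eq_two_or_odd.resolve_left (by lia)
  obtain ⟨e, he⟩ : ∃ e, 2 * p - 3 * c = e + 1 := ⟨2 * p - 3 * c - 1, by lia⟩
  have hq : 2 * c - p = 2 * M + 1 := by lia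
  have hdeg : 2 * (e + 1) + 3 * (2 * M + 1) = p := by lia
  let D : Derivation K (MvPolynomial (Fin 2) K) (MvPolynomial (Fin 2) K) := pderiv 0 + pderiv 1
  have hx : D (bp K) = 1 := by simp [D, bp, pderiv_X]
  have hy : D (bm K) = 1 := by simp [D, bm, pderiv_X]
  have hD : pderiv 0 vp + pderiv 1 vp = D vp := rfl
  have h2A : (2 : MvPolynomial (Fin 2) K) ≠ 0 := by
    simpa only [map_ofNat, C_0] using (C_injective (Fin 2) K).ne h2K
  have hterm (j : ℕ) (hj : j ∈ Finset.range (M + 1)) :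
      2 * D (sig2 K ^ (e + 1) * sig3 K * (C ((M.choose j : K) * ((2 * j + 1 : ℕ) : K)⁻¹) *
          (-4 * sig2 K ^ 3) ^ (M - j) * (-27 * sig3 K ^ 2) ^ j)) =
        sig2 K ^ e * (2 * sig2 K * D (sig3 K) - 3 * sig3 K * D (sig2 K)) *
          ((-27 * sig3 K ^ 2) ^ j * (-4 * sig2 K ^ 3) ^ (M - j) * (M.choose j : ℕ)) := by
    obtain ⟨i, rfl⟩ := Nat.exists_eq_add_of_le (Finset.mem_range_succ_iff.1 hj)
    rw [Nat.add_sub_cancel_left]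
    set a : K := ((j + i).choose j : K) * ((2 * j + 1 : ℕ) : K)⁻¹ * ((-4) ^ i * (-27) ^ j)
      with ha
    have hmon : sig2 K ^ (e + 1) * sig3 K *
        (C (((j + i).choose j : K) * ((2 * j + 1 : ℕ) : K)⁻¹) *
          (-4 * sig2 K ^ 3) ^ i * (-27 * sig3 K ^ 2) ^ j) =
        a • (sig2 K ^ (e + 3 * i + 1) * sig3 K ^ (2 * j + 1)) := by
      rw [ha, smul_eq_C_mul, C_mul (a' := (-4) ^ i * _), C_mul (a := (-4) ^ i), C_pow, C_pow,
        C_neg, C_neg, map_ofNat, map_ofNat]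
      ring
    have hcoef : (C a : MvPolynomial (Fin 2) K) * ((2 * j + 1 : ℕ) : MvPolynomial (Fin 2) K) =
        ((j + i).choose j : ℕ) * ((-4) ^ i * (-27) ^ j) := by
      have hinv := inv_mul_cancel₀ (hne (2 * j + 1) (by lia) (by lia))
      have : a * ((2 * j + 1 : ℕ) : K) = ((j + i).choose j : K) * ((-4) ^ i * (-27) ^ j) := by
        rw [ha]
        linear_combination ((j + i).choose j : K) * ((-4) ^ i * (-27) ^ j) * hinv
      rw [← C_eq_coe_nat, ← C_mul, this]
      simp only [C_mul, C_pow, C_neg, map_natCast, map_ofNat]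
    have hzero : ((2 * (e + 3 * i + 1) + 3 * (2 * j + 1) : ℕ) : MvPolynomial (Fin 2) K) = 0 := by
      rw [show 2 * (e + 3 * i + 1) + 3 * (2 * j + 1) = p by lia, CharP.cast_eq_zero]
    rw [hmon, D.map_smul, smul_eq_C_mul, mul_left_comm,
      two_mul_derivation_pow_mul_pow D _ _ _ _ hzero]
    linear_combination sig2 K ^ (e + 3 * i) * sig3 K ^ (2 * j) *
      (2 * sig2 K * D (sig3 K) - 3 * sig3 K * D (sig2 K)) * hcoef
  have hmain : pderiv 0 vp + pderiv 1 vp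
      = (12 : K)⁻¹ • (sig2 K ^ (2 * p - 3 * c - 1) * qq K ^ (2 * c - p)
          * (bm K - bp K)) := by
    apply mul_left_cancel₀ h2A
    rw [hD, hvp, he, Finset.mul_sum, map_sum, Finset.mul_sum, Finset.sum_congr rfl hterm,
      ← Finset.mul_sum, ← add_pow, add_comm (-27 * sig3 K ^ 2),
      neg_four_mul_sig2_cube_add K h2K h3K, sig2_sig3_wronskian K h2K h3K D hx hy, hq,
      Nat.add_sub_cancel, smul_eq_C_mul]
    ring
  refine ⟨hmain, ?_⟩
  rw [hmain, Ideal.mem_span_singleton]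
  exact ⟨(12 : K)⁻¹ • (sig2 K ^ (2 * p - 3 * c - 1) * (bm K - bp K)), by
    simp only [smul_eq_C_mul]; ring⟩

end
end

section
/- Let K be a field of characteristic p > 3 and c ∈ K. Suppose a₊₊, a₊₋, a₋₊, a₋₋ ∈ R = K[b₊, b₋] are homogeneous of degree p and satisfy: (i) (12)·a₊₊ = a₊₊, (12)·a₊₋ = -a₊₋, (12)·a₋₊ = -a₋₊, (12)·a₋₋ = a₋₋; (ii) (23)·a₊₊ = (1/4)(a₊₊ - a₊₋ - 3a₋₊ + 3a₋₋), (23)·a₊₋ = (1/4)(-3a₊₊ - a₊₋ + 9a₋₊ + 3a₋₋), (23)·a₋₊ = (1/4)(-a₊₊ + a₊₋ - a₋₊ + a₋₋), (23)·a₋₋ = (1/4)(3a₊₊ + a₊₋ + 3a₋₊ + a₋₋); and (iii) the cleared-denominator differential relations (b₊+b₋)·∂a₊₊ = -c(a₊₋ - 3a₋₊), b₋(b₊+b₋)·∂a₊₋ = -2c(b₊+b₋)a₊₋ + c·b₋·(-3a₊₊ + 2a₊₋ + 3a₋₋), b₋(b₊+b₋)·∂a₋₊ = 2c(b₊+b₋)a₋₊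 - c·b₋·(-a₊₊ + 2a₋₊ + a₋₋), (b₊+b₋)·∂a₋₋ = c(a₊₋ - 3a₋₊). Then Det := a₊₊a₋₋ - a₊₋a₋₊ is S₃-invariant (g·Det = Det for all g ∈ S₃), satisfies ∂(Det) = 0, and consequently Det = λ·σ₂^p for some λ ∈ K. -/
open MvPolynomial

noncomputable section

/-- The two elements `(12)` and `(23)` generate `S₃`. -/
theorem perm_fin_three_mem_of_swaps (H : Subgroup (Equiv.Perm (Fin 3)))
    (h01 : Equiv.swap 0 1 ∈ H) (h12 : Equiv.swap 1 2 ∈ H) (g : Equiv.Perm (Fin 3)) : g ∈ H := by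
  have key : ∀ g : Equiv.Perm (Fin 3), g = 1 ∨ g = Equiv.swap 0 1 ∨ g = Equiv.swap 1 2 ∨
      g = Equiv.swap 0 1 * Equiv.swap 1 2 ∨ g = Equiv.swap 1 2 * Equiv.swap 0 1 ∨
      g = Equiv.swap 0 1 * Equiv.swap 1 2 * Equiv.swap 0 1 := by decide
  rcases key g with rfl | rfl | rfl | rfl | rfl | rfl
  · exact H.one_mem
  · exact h01
  · exact h12
  · exact H.mul_mem h01 h12
  · exact H.mul_mem h12 h01
  · exact H.mul_mem (H.mul_mem h01 h12) h01

theorem MvPolynomial.natCast_eq_zero_of_pderiv_eq_zero {σ K : Type*} [Field K]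
    {f : MvPolynomial σ K} {i : σ} (h : pderiv i f = 0) {m : σ →₀ ℕ} (hm : coeff m f ≠ 0) :
    (m i : K) = 0 := by
  classical
  by_cases h0 : m i = 0
  · simp [h0]
  have hle : Finsupp.single i 1 ≤ m := by
    rw [Finsupp.single_le_iff]; omega
  have hc := congrArg (coeff (m - Finsupp.single i 1)) h
  rw [coeff_pderiv, tsub_add_cancel_of_le hle, coeff_zero] at hc
  have hsub : (m - Finsupp.single i 1 : σ →₀ ℕ) i + 1 = m i := by
    rw [Finsupp.tsub_apply, Finsupp.single_eq_same]; omega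
  rw [← Nat.cast_add_one, hsub] at hc
  exact (mul_eq_zero.mp hc).resolve_left hm

/-- In characteristic `p`, a homogeneous binary form of degree `2p` with vanishing partial
derivatives is a quadratic form in the `p`-th powers of the variables. -/
theorem MvPolynomial.IsHomogeneous.exists_eq_of_pderiv_eq_zero {K : Type*} [Field K] {p : ℕ}
    [CharP K p] (hp : p ≠ 0) {f : MvPolynomial (Fin 2) K} (hf : f.IsHomogeneous (p + p))
    (h : ∀ i, pderiv i f = 0) :
    ∃ α β γ : K, f = C α * (X 0 ^ p) ^ 2 + C β * (X 0 ^ p * X 1 ^ p) + C γ * (X 1 ^ p) ^ 2 := by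
  classical
  set e : ℕ → ℕ → (Fin 2 →₀ ℕ) := fun a b => Finsupp.single 0 a + Finsupp.single 1 b with he
  have hmon : ∀ (a b : ℕ) (r : K), monomial (e a b) r = C r * (X 0 ^ a * X 1 ^ b) := by
    intro a b r
    simp [he, C_mul_monomial, X_pow_eq_monomial, monomial_mul]
  have he_inj : ∀ a b a' b', e a b = e a' b' ↔ a = a' ∧ b = b' := by
    intro a b a' b'
    constructor
    · intro h'
      exact ⟨by simpa [he] using DFunLike.congr_fun h' 0,
        by simpa [he] using DFunLike.congr_fun h' 1⟩
    · rintro ⟨rfl, rfl⟩; rfl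
  refine ⟨coeff (e (p * 2) 0) f, coeff (e p p) f, coeff (e 0 (p * 2)) f, ?_⟩
  have hsum : f = monomial (e (p * 2) 0) (coeff (e (p * 2) 0) f)
      + monomial (e p p) (coeff (e p p) f)
      + monomial (e 0 (p * 2)) (coeff (e 0 (p * 2)) f) := by
    ext m
    obtain ⟨a, b, rfl⟩ : ∃ a b, m = e a b := ⟨m 0, m 1, by
      ext i; fin_cases i <;> simp [he]⟩
    simp only [coeff_add, coeff_monomial, he_inj]
    by_cases hm : coeff (e a b) f = 0
    · rw [hm]
      split_ifs with h1 h2 h3 h3 h2 h3 h3 <;> grind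
    have hdeg := hf hm
    have hab : a + b = p + p := by
      simpa [he, Finsupp.weight_apply, Finsupp.sum_fintype] using hdeg
    have ha : p ∣ a := by
      simpa [he, CharP.cast_eq_zero_iff K p] using natCast_eq_zero_of_pderiv_eq_zero (h 0) hm
    obtain ⟨k, rfl⟩ := ha
    have hk : k ≤ 2 := by
      by_contra hk
      have : p * 3 ≤ p * k := Nat.mul_le_mul_left p (by omega)
      omega
    interval_cases k
    · obtain rfl : b = p * 2 := by omega
      simp [hp]
    · obtain rfl : b = p := by omega
      simp [hp]
    · obtain rfl : b = 0 := by omega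
      simp [hp]
  conv_lhs => rw [hsum]
  simp only [hmon, pow_zero, one_mul, mul_one, pow_mul]

/-- The determinant `Det = a₊₊a₋₋ - a₊₋a₋₊` of the components of the two degree-`p`
singular vectors of `M_{1,c}(Stand)` is `S₃`-invariant, killed by `∂ = ∂_{y₁}`, and hence
a scalar multiple of `σ₂^p`. -/
theorem stmt_15 (K : Type*) [Field K] (p : ℕ) [CharP K p] (hp : p.Prime) (h3 : 3 < p)
    (c : K)
    (ρ : Equiv.Perm (Fin 3) →* (MvPolynomial (Fin 2) K ≃ₐ[K] MvPolynomial (Fin 2) K))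
    (hρ12p : ρ (Equiv.swap 0 1) (bp K) = bp K)
    (hρ12m : ρ (Equiv.swap 0 1) (bm K) = -bm K)
    (hρ23p : ρ (Equiv.swap 1 2) (bp K) = (2 : K)⁻¹ • (-bp K + 3 * bm K))
    (hρ23m : ρ (Equiv.swap 1 2) (bm K) = (2 : K)⁻¹ • (bp K + bm K))
    (app apm amp amm : MvPolynomial (Fin 2) K)
    (hdeg : app.IsHomogeneous p ∧ apm.IsHomogeneous p ∧ amp.IsHomogeneous p ∧
        amm.IsHomogeneous p)
    -- (i) symmetry under (12):
    (h12pp : ρ (Equiv.swap 0 1) app = app)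
    (h12pm : ρ (Equiv.swap 0 1) apm = -apm)
    (h12mp : ρ (Equiv.swap 0 1) amp = -amp)
    (h12mm : ρ (Equiv.swap 0 1) amm = amm)
    -- (ii) symmetry under (23):
    (h23pp : ρ (Equiv.swap 1 2) app = (4 : K)⁻¹ • (app - apm - 3 * amp + 3 * amm))
    (h23pm : ρ (Equiv.swap 1 2) apm = (4 : K)⁻¹ • (-(3 * app) - apm + 9 * amp + 3 * amm))
    (h23mp : ρ (Equiv.swap 1 2) amp = (4 : K)⁻¹ • (-app + apm - amp + amm))
    (h23mm : ρ (Equiv.swap 1 2) amm = (4 : K)⁻¹ • (3 * app + apm + 3 * amp + amm))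
    -- (iii) cleared-denominator differential (Dunkl) relations, with `∂b₊ = ∂b₋ = 1`:
    (hdpp : (bp K + bm K) * (pderiv 0 app + pderiv 1 app) = -(C c * (apm - 3 * amp)))
    (hdpm : bm K * (bp K + bm K) * (pderiv 0 apm + pderiv 1 apm)
        = -(2 * C c * ((bp K + bm K) * apm))
          + C c * (bm K * (-(3 * app) + 2 * apm + 3 * amm)))
    (hdmp : bm K * (bp K + bm K) * (pderiv 0 amp + pderiv 1 amp)
        = 2 * C c * ((bp K + bm K) * amp)
          - C c * (bm K * (-app + 2 * amp + amm)))
    (hdmm : (bp K + bm K) * (pderiv 0 amm + pderiv 1 amm) = C c * (apm - 3 * amp)) :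
    (∀ g : Equiv.Perm (Fin 3), ρ g (app * amm - apm * amp) = app * amm - apm * amp) ∧
    (pderiv 0 (app * amm - apm * amp) + pderiv 1 (app * amm - apm * amp) = 0) ∧
    ∃ l : K, app * amm - apm * amp = l • sig2 K ^ p := by
  have : Fact p.Prime := ⟨hp⟩
  have hnat (n : ℕ) (hn : 0 < n) (hlt : n < p) : (n : K) ≠ 0 := fun h =>
    absurd (Nat.le_of_dvd hn ((CharP.cast_eq_zero_iff K p n).mp h)) (by omega)
  have h2 : (2 : K) ≠ 0 := by exact_mod_cast hnat 2 (by norm_num) (by omega)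
  have h3' : (3 : K) ≠ 0 := by exact_mod_cast hnat 3 (by norm_num) h3
  have h4 : (4 : K) ≠ 0 := by
    rw [show (4 : K) = 2 * 2 by norm_num]; exact mul_ne_zero h2 h2
  have h12 : (12 : K) ≠ 0 := by
    rw [show (12 : K) = 4 * 3 by norm_num]; exact mul_ne_zero h4 h3'
  set f := app * amm - apm * amp with hf
  have hs12 : ρ (Equiv.swap 0 1) f = f := by
    rw [hf]; simp only [map_sub, map_mul, h12pp, h12pm, h12mp, h12mm]; ring
  have hs23 : ρ (Equiv.swap 1 2) f = f := by
    have hC : (C (4 : K)⁻¹ : MvPolynomial (Fin 2) K) * 4 = 1 := by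
      rw [show (4 : MvPolynomial (Fin 2) K) = C 4 from (map_ofNat C 4).symm, ← C_mul,
        inv_mul_cancel₀ h4, C_1]
    rw [hf]
    simp only [map_sub, map_mul, h23pp, h23pm, h23mp, h23mm, smul_eq_C_mul]
    linear_combination (app * amm - apm * amp) * (C (4 : K)⁻¹ * 4 + 1) * hC
  have hd : pderiv 0 f + pderiv 1 f = 0 := by
    have hm : bm K ≠ 0 := X_ne_zero 1
    have hs : bp K + bm K ≠ 0 := by
      intro h
      simpa [bp, bm] using congrArg (eval (fun i : Fin 2 => if i = 0 then (1 : K) else 0)) h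
    refine (mul_eq_zero.mp ?_).resolve_left (mul_ne_zero hm hs)
    simp only [hf, map_sub, Derivation.leibniz, smul_eq_mul]
    linear_combination bm K * amm * hdpp + bm K * app * hdmm - amp * hdpm - apm * hdmp
  refine ⟨?_, hd, ?_⟩
  · exact perm_fin_three_mem_of_swaps
      { carrier := {g | ρ g f = f}
        one_mem' := by simp
        mul_mem' := fun {a b} (ha : ρ a f = f) (hb : ρ b f = f) => by
          change ρ (a * b) f = f
          rw [map_mul, AlgEquiv.mul_apply, hb, ha]
        inv_mem' := fun {a} (ha : ρ a f = f) => by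
          change ρ a⁻¹ f = f
          conv_lhs => rw [← ha]
          rw [← AlgEquiv.mul_apply, ← map_mul, inv_mul_cancel, map_one, AlgEquiv.one_apply] }
      hs12 hs23
  have hC (r : K) (g : Equiv.Perm (Fin 3)) : ρ g (C r) = C r := (ρ g).commutes r
  have hX0 : ρ (Equiv.swap 0 1) (X 0) = X 0 := hρ12p
  have hX1 : ρ (Equiv.swap 0 1) (X 1) = -X 1 := hρ12m
  have hcomm : ∀ g : MvPolynomial (Fin 2) K,
      pderiv 0 (ρ (Equiv.swap 0 1) g) = ρ (Equiv.swap 0 1) (pderiv 0 g) ∧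
      pderiv 1 (ρ (Equiv.swap 0 1) g) = -ρ (Equiv.swap 0 1) (pderiv 1 g) := by
    intro g
    induction g using MvPolynomial.induction_on with
    | C a => simp [hC]
    | add g₁ g₂ h₁ h₂ =>
      simp only [map_add, h₁.1, h₁.2, h₂.1, h₂.2, neg_add, true_and]
    | mul_X g i hg =>
      fin_cases i <;> constructor <;>
        simp [hg.1, hg.2, hX0, hX1, pderiv_X]
  have hd' : pderiv 0 f - pderiv 1 f = 0 := by
    have h := congrArg (ρ (Equiv.swap 0 1)) hd
    have h0 := (hcomm f).1
    have h1 := (hcomm f).2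
    rw [hs12] at h0 h1
    rw [map_add, map_zero] at h
    linear_combination h + h0 - h1
  have h2ne : (2 : MvPolynomial (Fin 2) K) ≠ 0 := by
    rw [show (2 : MvPolynomial (Fin 2) K) = C 2 from (map_ofNat C 2).symm]
    exact C_ne_zero.mpr h2
  have hd0 : pderiv 0 f = 0 :=
    (mul_eq_zero.mp (by linear_combination hd + hd' : 2 * pderiv 0 f = 0)).resolve_left h2ne
  have hd1 : pderiv 1 f = 0 := by linear_combination hd - hd0
  have hhom : f.IsHomogeneous (p + p) :=
    (hdeg.1.mul hdeg.2.2.2).sub (hdeg.2.1.mul hdeg.2.2.1)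
  obtain ⟨α, β, γ, hfe⟩ := hhom.exists_eq_of_pderiv_eq_zero hp.ne_zero
    (Fin.forall_fin_two.mpr ⟨hd0, hd1⟩)
  have hodd : Odd p := hp.odd_of_ne_two (by omega)
  have hfrob2 : (2 : K) ^ p = 2 := by simpa [frobenius_def] using map_ofNat (frobenius K p) 2
  have hfrob12 : (12 : K) ^ p = 12 := by simpa [frobenius_def] using map_ofNat (frobenius K p) 12
  have hβ : β = 0 := by
    have h := hs12
    rw [hfe] at h
    simp only [map_add, map_mul, map_pow, hC, hX0, hX1] at h
    have h' := congrArg (eval (fun _ : Fin 2 => (1 : K))) h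
    simp [hodd.neg_one_pow] at h'
    have : 2 * β = 0 := by linear_combination -h'
    exact (mul_eq_zero.mp this).resolve_left h2
  subst hβ
  have hγ : γ = 3 * α := by
    have h := hs23
    rw [hfe] at h
    rw [bp] at hρ23p
    rw [bm] at hρ23m
    simp only [map_add, map_mul, map_pow, hC, hρ23p, hρ23m] at h
    have h' := congrArg (eval (fun i : Fin 2 => if i = 0 then (1 : K) else 0)) h
    simp [bp, bm, hodd.neg_pow, hp.ne_zero, smul_eq_C_mul, hfrob2] at h'
    field_simp at h'
    linear_combination h'
  subst hγ
  refine ⟨-12 * α, ?_⟩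
  have hfrob3 : (3 : MvPolynomial (Fin 2) K) ^ p = 3 := by
    simpa [frobenius_def] using map_ofNat (frobenius (MvPolynomial (Fin 2) K) p) 3
  rw [hfe, sig2, smul_pow, hodd.neg_pow, add_pow_char, mul_pow, hfrob3, inv_pow, hfrob12,
    smul_smul, show -12 * α * (12 : K)⁻¹ = -α by field_simp, smul_eq_C_mul]
  simp only [bp, bm, map_zero, map_neg, map_mul, map_ofNat]
  ring

end
end

section
/- Let K be a field of characteristic p > 3 with p ≡ 1 (mod 3), let c be an integer with 0 < c < p/3, and set N := (p-1)/3 - c. Define λᵢ := ((-1)^i / 9^i) · (N·(N-1)⋯(N-2i+1)) / (i! · Π_{j=1}^{i}(3j-2)) for 0 ≤ i ≤ ⌊N/2⌋, and μᵢ := ((-1)^{i+1} / (6·9^i)) · (N·(N-1)⋯(N-2i)) / (i! · Π_{j=1}^{i+1}(3j-2)) for 0 ≤ i ≤ ⌊(N-1)/2⌋ (all fractions interpreted in K). In R = K[b₊, b₋], set F := Σᵢ λᵢ σ₂^{3i} σ₃^{N-2i} b₊ + Σᵢ μᵢ σ₂^{3i+1} σ₃^{N-2i-1} (-b₊²+3b₋²)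 and G := Σᵢ λᵢ σ₂^{3i} σ₃^{N-2i} · 3b₋ + Σᵢ μᵢ σ₂^{3i+1} σ₃^{N-2i-1} · 3·(2b₊b₋). Then, with g := (13), the following two identities hold: b₋(b₊+b₋)·∂F = c·[(b₊+b₋)(F - (12)·F) - b₋·((F - g·F) + (G - g·G))] and b₋(b₊+b₋)·∂G = c·[-(b₊+b₋)(G - (12)·G) - b₋·(3(F - g·F) - (G - g·G))]. -/
open MvPolynomial

noncomputable section

/-- The weighted sums `A` and `B` in the quasi-invariants `s`, `t` that make up the coefficients
of the singular vector satisfy the chain rule with formal partial derivatives `A₂, A₃, B₂, B₃`,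
the Euler relations, and a first-order system linking `A` and `B`. -/
lemma exists_formal_partials {K R : Type*} [CommRing K] [CommRing R] [Algebra K R]
    (D : Derivation K R R) (N : ℕ) (a b : ℕ → K) (s t : R)
    (ha : ∀ i, N < 2 * i → a i = 0) (hb : ∀ i, N < 2 * i + 1 → b i = 0)
    (hab : ∀ i < N, 3 * ((i + 1 : ℕ) : K) * a (i + 1) = 2 * ((N - 2 * i - 1 : ℕ) : K) * b i)
    (hba : ∀ i ≤ N, 6 * ((3 * i + 1 : ℕ) : K) * b i = -(((N - 2 * i : ℕ) : K) * a i))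
    (A B : R)
    (hA : A = ∑ i ∈ Finset.range (N + 1), algebraMap K R (a i) * s ^ (3 * i) * t ^ (N - 2 * i))
    (hB : B = ∑ i ∈ Finset.range (N + 1),
      algebraMap K R (b i) * s ^ (3 * i + 1) * t ^ (N - 2 * i - 1)) :
    ∃ A₂ A₃ B₂ B₃ : R, D A = A₂ * D s + A₃ * D t ∧ D B = B₂ * D s + B₃ * D t ∧
      A₂ = 2 * s * B₃ ∧ 6 * B₂ = -A₃ ∧
      2 * s * A₂ + 3 * t * A₃ = 3 * N * A ∧ 2 * s * B₂ + 3 * t * B₃ = (3 * N - 1) * B := by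
  refine ⟨∑ i ∈ Finset.range (N + 1),
      algebraMap K R (a i) * (((3 * i : ℕ) : R) * s ^ (3 * i - 1)) * t ^ (N - 2 * i),
    ∑ i ∈ Finset.range (N + 1),
      algebraMap K R (a i) * s ^ (3 * i) * (((N - 2 * i : ℕ) : R) * t ^ (N - 2 * i - 1)),
    ∑ i ∈ Finset.range (N + 1),
      algebraMap K R (b i) * (((3 * i + 1 : ℕ) : R) * s ^ (3 * i)) * t ^ (N - 2 * i - 1),
    ∑ i ∈ Finset.range (N + 1), algebraMap K R (b i) * s ^ (3 * i + 1) *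
      (((N - 2 * i - 1 : ℕ) : R) * t ^ (N - 2 * i - 1 - 1)), ?_, ?_, ?_, ?_, ?_, ?_⟩
  · rw [hA, map_sum, Finset.sum_mul, Finset.sum_mul, ← Finset.sum_add_distrib]
    refine Finset.sum_congr rfl fun i _ => ?_
    simp only [Derivation.leibniz, Derivation.leibniz_pow, Derivation.map_algebraMap, smul_eq_mul,
      nsmul_eq_mul]
    ring
  · rw [hB, map_sum, Finset.sum_mul, Finset.sum_mul, ← Finset.sum_add_distrib]
    refine Finset.sum_congr rfl fun i _ => ?_
    simp only [Derivation.leibniz, Derivation.leibniz_pow, Derivation.map_algebraMap, smul_eq_mul,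
      nsmul_eq_mul, Nat.add_sub_cancel]
    ring
  · rw [Finset.sum_range_succ', Finset.sum_range_succ _ N, hb N (by omega), mul_add (2 * s),
      Finset.mul_sum]
    simp only [map_zero, zero_mul, mul_zero, Nat.cast_zero, add_zero]
    refine Finset.sum_congr rfl fun i hi => ?_
    have h := congrArg (algebraMap K R) (hab i (Finset.mem_range.1 hi))
    simp only [map_mul, map_natCast, map_ofNat] at h
    rw [show 3 * (i + 1) - 1 = 3 * i + 2 by omega,
      show N - 2 * (i + 1) = N - 2 * i - 1 - 1 by omega, Nat.cast_mul, Nat.cast_ofNat]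
    linear_combination s ^ (3 * i + 2) * t ^ (N - 2 * i - 1 - 1) * h
  · rw [Finset.mul_sum, ← Finset.sum_neg_distrib]
    refine Finset.sum_congr rfl fun i hi => ?_
    have h := congrArg (algebraMap K R) (hba i (Nat.lt_succ_iff.1 (Finset.mem_range.1 hi)))
    simp only [map_mul, map_neg, map_natCast, map_ofNat] at h
    linear_combination s ^ (3 * i) * t ^ (N - 2 * i - 1) * h
  · rw [hA, Finset.mul_sum, Finset.mul_sum, Finset.mul_sum, ← Finset.sum_add_distrib]
    refine Finset.sum_congr rfl fun i _ => ?_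
    rcases lt_or_ge N (2 * i) with hi | hi
    · simp [ha i hi]
    · obtain ⟨m, rfl⟩ := Nat.exists_eq_add_of_le hi
      have hs : s * (((3 * i : ℕ) : R) * s ^ (3 * i - 1)) = ((3 * i : ℕ) : R) * s ^ (3 * i) := by
        rcases Nat.eq_zero_or_pos (3 * i) with h | h
        · simp [h]
        · rw [← mul_pow_sub_one h.ne' s]; ring
      have ht : t * ((m : R) * t ^ (m - 1)) = (m : R) * t ^ m := by
        rcases Nat.eq_zero_or_pos m with h | h
        · simp [h]
        · rw [← mul_pow_sub_one h.ne' t]; ring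
      rw [Nat.add_sub_cancel_left]
      push_cast at hs ⊢
      linear_combination 2 * algebraMap K R (a i) * t ^ m * hs +
        3 * algebraMap K R (a i) * s ^ (3 * i) * ht
  · rw [hB, Finset.mul_sum, Finset.mul_sum, Finset.mul_sum, ← Finset.sum_add_distrib]
    refine Finset.sum_congr rfl fun i _ => ?_
    rcases lt_or_ge N (2 * i + 1) with hi | hi
    · simp [hb i hi]
    · obtain ⟨m, rfl⟩ := Nat.exists_eq_add_of_le hi
      have ht : t * ((m : R) * t ^ (m - 1)) = (m : R) * t ^ m := by
        rcases Nat.eq_zero_or_pos m with h | h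
        · simp [h]
        · rw [← mul_pow_sub_one h.ne' t]; ring
      rw [show 2 * i + 1 + m - 2 * i - 1 = m by omega]
      push_cast
      linear_combination 3 * algebraMap K R (b i) * s ^ (3 * i + 1) * ht

/-- Both components of the cleared-denominator Dunkl equation, in coordinates `x = b₊ / 6` and
`y = b₋ / 6` that make all coefficients integral. -/
lemma dunkl_components_of_system {R : Type*} [CommRing R]
    (x y c n A A₂ A₃ B B₂ B₃ DA DB : R) (hc : 3 * c = -1 - 3 * n)
    (hDA : DA = A₂ * -(x + 3 * y) + A₃ * -(x ^ 2 - 3 * y ^ 2 - 6 * x * y))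
    (hDB : DB = B₂ * -(x + 3 * y) + B₃ * -(x ^ 2 - 3 * y ^ 2 - 6 * x * y))
    (hA₂ : A₂ = 2 * (-3 * (x ^ 2 + 3 * y ^ 2)) * B₃) (hB₂ : 6 * B₂ = -A₃)
    (hA : 2 * (-3 * (x ^ 2 + 3 * y ^ 2)) * A₂ + 3 * (-2 * (x ^ 3 - 9 * x * y ^ 2)) * A₃
      = 3 * n * A)
    (hB : 2 * (-3 * (x ^ 2 + 3 * y ^ 2)) * B₂ + 3 * (-2 * (x ^ 3 - 9 * x * y ^ 2)) * B₃
      = (3 * n - 1) * B) :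
    6 * y * (6 * x + 6 * y) * (DA * (6 * x) + A + (DB * (36 * (-x ^ 2 + 3 * y ^ 2))
        + B * (-12 * x + 36 * y)))
      = c * -(6 * y * (A * (18 * (x + y)) + B * (-108 * (x + y) * (x - 3 * y)))) ∧
    6 * y * (6 * x + 6 * y) * (DA * (18 * y) + 3 * A + (DB * (216 * x * y)
        + B * (36 * (x + y))))
      = c * (-((6 * x + 6 * y) * (2 * (A * (18 * y) + B * (216 * x * y))))
        - 6 * y * (A * (18 * (x + y)) + B * (-108 * (x + y) * (x - 3 * y)))) := by
  subst hDA hDB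
  obtain rfl : A₃ = -(6 * B₂) := by linear_combination hB₂
  subst hA₂
  constructor
  · linear_combination 36 * y * (x + y) * (A - 6 * (x - 3 * y) * B) * hc
      + 36 * y * (x + y) * hA - 216 * y * (x + y) * (x - 3 * y) * hB
  · linear_combination 108 * y * (x + y) * (A + 6 * (x + y) * B) * hc
      + 108 * y * (x + y) * hA + 648 * y * (x + y) ^ 2 * hB

/-- The singular vector `v_{p-3c} = F⊗b₊ + G⊗b₋` of type `Triv` in degree `p-3c` of
`M_{1,c}(Stand)` for `p ≡ 1 (mod 3)` and `0 < c < p/3`: the two displayed identities are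
the cleared-denominator `b₊`- and `b₋`-components of `D_{y₁}(F⊗b₊ + G⊗b₋) = 0`. -/
theorem stmt_17 (K : Type*) [Field K] (p : ℕ) [CharP K p] (hp : p.Prime) (h3 : 3 < p)
    (hpmod : p % 3 = 1) (c N : ℕ) (hc0 : 0 < c) (hc1 : 3 * c < p)
    (hN : N = (p - 1) / 3 - c)
    (lam mu : ℕ → K)
    (hlam : ∀ i, lam i = (-1 : K) ^ i * ((9 : K) ^ i)⁻¹ *
        (N.descFactorial (2 * i) : K) /
        ((i.factorial : K) * ∏ j ∈ Finset.range i, ((3 * j + 1 : ℕ) : K)))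
    (hmu : ∀ i, mu i = (-1 : K) ^ (i + 1) * ((6 : K) * (9 : K) ^ i)⁻¹ *
        (N.descFactorial (2 * i + 1) : K) /
        ((i.factorial : K) * ∏ j ∈ Finset.range (i + 1), ((3 * j + 1 : ℕ) : K)))
    (F G : MvPolynomial (Fin 2) K)
    (hF : F = (∑ i ∈ Finset.range (N / 2 + 1),
          C (lam i) * sig2 K ^ (3 * i) * sig3 K ^ (N - 2 * i) * bp K)
        + ∑ i ∈ Finset.range ((N + 1) / 2),
          C (mu i) * sig2 K ^ (3 * i + 1) * sig3 K ^ (N - 2 * i - 1)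
            * (-(bp K ^ 2) + 3 * bm K ^ 2))
    (hG : G = (∑ i ∈ Finset.range (N / 2 + 1),
          C (lam i) * sig2 K ^ (3 * i) * sig3 K ^ (N - 2 * i) * (3 * bm K))
        + ∑ i ∈ Finset.range ((N + 1) / 2),
          C (mu i) * sig2 K ^ (3 * i + 1) * sig3 K ^ (N - 2 * i - 1)
            * (3 * (2 * bp K * bm K))) :
    bm K * (bp K + bm K) * (pderiv 0 F + pderiv 1 F)
        = C ((c : K)) * ((bp K + bm K) * (F - s12 K F)
            - bm K * ((F - s13 K F) + (G - s13 K G))) ∧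
    bm K * (bp K + bm K) * (pderiv 0 G + pderiv 1 G)
        = C ((c : K)) * (-((bp K + bm K) * (G - s12 K G))
            - bm K * (3 * (F - s13 K F) - (G - s13 K G))) := by
  have hcast : ∀ n : ℕ, 0 < n → n < p → (n : K) ≠ 0 := fun n hn hnp h =>
    Nat.not_dvd_of_pos_of_lt hn hnp ((CharP.cast_eq_zero_iff K p n).1 h)
  have hNp : 3 * c + 3 * N + 1 = p := by omega
  have h2 : (2 : K) ≠ 0 := by exact_mod_cast hcast 2 (by omega) (by omega)
  have h3' : (3 : K) ≠ 0 := by exact_mod_cast hcast 3 (by omega) h3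
  have h6 : (6 : K) ≠ 0 := by
    rw [show (6 : K) = 2 * 3 by norm_num]; exact mul_ne_zero h2 h3'
  have h9 : (9 : K) ≠ 0 := by
    rw [show (9 : K) = 3 * 3 by norm_num]; exact mul_ne_zero h3' h3'
  have hc : 3 * C (c : K) = -1 - 3 * (N : MvPolynomial (Fin 2) K) := by
    have h : 3 * (c : MvPolynomial (Fin 2) K) + 3 * N + 1 = 0 := by
      have := congrArg (Nat.cast (R := MvPolynomial (Fin 2) K)) hNp
      rw [CharP.cast_eq_zero (MvPolynomial (Fin 2) K) p] at this
      exact_mod_cast this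
    rw [map_natCast]
    linear_combination h
  have hlam0 : ∀ i, N < 2 * i → lam i = 0 := fun i hi => by
    simp [hlam, Nat.descFactorial_of_lt hi]
  have hmu0 : ∀ i, N < 2 * i + 1 → mu i = 0 := fun i hi => by
    rw [hmu, Nat.descFactorial_of_lt hi]; simp
  have hlammu : ∀ i < N,
      3 * ((i + 1 : ℕ) : K) * lam (i + 1) = 2 * ((N - 2 * i - 1 : ℕ) : K) * mu i := by
    intro i hi
    have hi1 := hcast (i + 1) (by omega) (by omega)
    rw [hlam, hmu, show 2 * (i + 1) = (2 * i + 1) + 1 by ring, Nat.descFactorial_succ,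
      Nat.factorial_succ, Nat.sub_sub]
    push_cast at hi1 ⊢
    simp only [div_eq_mul_inv, mul_inv, pow_succ]
    rw [show (9 : K)⁻¹ = 3⁻¹ * 3⁻¹ by rw [← mul_inv]; norm_num,
      show (6 : K)⁻¹ = 2⁻¹ * 3⁻¹ by rw [← mul_inv]; norm_num]
    field_simp
  have hmulam : ∀ i ≤ N,
      6 * ((3 * i + 1 : ℕ) : K) * mu i = -(((N - 2 * i : ℕ) : K) * lam i) := by
    intro i hi
    have hi1 := hcast (3 * i + 1) (by omega) (by omega)
    rw [hlam, hmu, Nat.descFactorial_succ, Finset.prod_range_succ]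
    push_cast at hi1 ⊢
    simp only [div_eq_mul_inv, mul_inv, pow_succ]
    field_simp
  set A : MvPolynomial (Fin 2) K := ∑ i ∈ Finset.range (N + 1),
    algebraMap K _ (lam i) * sig2 K ^ (3 * i) * sig3 K ^ (N - 2 * i) with hA
  set B : MvPolynomial (Fin 2) K := ∑ i ∈ Finset.range (N + 1),
    algebraMap K _ (mu i) * sig2 K ^ (3 * i + 1) * sig3 K ^ (N - 2 * i - 1) with hB
  have hA' : ∑ i ∈ Finset.range (N / 2 + 1),
      C (lam i) * sig2 K ^ (3 * i) * sig3 K ^ (N - 2 * i) = A := by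
    refine Finset.sum_subset (Finset.range_mono (by omega)) fun i _ hi => ?_
    rw [Finset.mem_range] at hi
    simp [hlam0 i (by omega)]
  have hB' : ∑ i ∈ Finset.range ((N + 1) / 2),
      C (mu i) * sig2 K ^ (3 * i + 1) * sig3 K ^ (N - 2 * i - 1) = B := by
    refine Finset.sum_subset (Finset.range_mono (by omega)) fun i _ hi => ?_
    rw [Finset.mem_range] at hi
    simp [hmu0 i (by omega)]
  rw [← Finset.sum_mul, ← Finset.sum_mul, hA', hB'] at hF hG
  obtain ⟨x, hx⟩ : ∃ x : MvPolynomial (Fin 2) K, x = C (6⁻¹) * X 0 := ⟨_, rfl⟩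
  obtain ⟨y, hy⟩ : ∃ y : MvPolynomial (Fin 2) K, y = C (6⁻¹) * X 1 := ⟨_, rfl⟩
  have hC6 : (6 : MvPolynomial (Fin 2) K) * C (6⁻¹) = 1 := by
    rw [← map_ofNat C 6, ← map_mul, mul_inv_cancel₀ h6, map_one]
  have hX0 : (X 0 : MvPolynomial (Fin 2) K) = 6 * x := by
    rw [hx, ← mul_assoc, hC6, one_mul]
  have hX1 : (X 1 : MvPolynomial (Fin 2) K) = 6 * y := by
    rw [hy, ← mul_assoc, hC6, one_mul]
  have hC12 : (C (12⁻¹) : MvPolynomial (Fin 2) K) = 3 * C (6⁻¹) ^ 2 := by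
    rw [← map_ofNat C 3, ← map_pow, ← map_mul, show (12 : K) = 2 * 6 by norm_num]
    congr 1; field_simp; norm_num
  have hC108 : (C (108⁻¹) : MvPolynomial (Fin 2) K) = 2 * C (6⁻¹) ^ 3 := by
    rw [← map_ofNat C 2, ← map_pow, ← map_mul, show (108 : K) = 3 * 6 ^ 2 by norm_num]
    congr 1; field_simp; norm_num
  have hbp : bp K = 6 * x := hX0
  have hbm : bm K = 6 * y := hX1
  have hs2 : sig2 K = -3 * (x ^ 2 + 3 * y ^ 2) := by
    rw [sig2, smul_eq_C_mul, hC12, bp, bm, hx, hy]; ring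
  have hs3 : sig3 K = -2 * (x ^ 3 - 9 * x * y ^ 2) := by
    rw [sig3, smul_eq_C_mul, hC108, bp, bm, hx, hy]; ring
  have h12x : s12 K x = x := by simp [s12, hx, algebraMap_eq]
  have h12y : s12 K y = -y := by simp [s12, hy, algebraMap_eq]
  have h13x : s13 K x = C (2⁻¹) * (-x - 3 * y) := by
    simp [s13, hx, hy, algebraMap_eq, smul_eq_C_mul]; ring
  have h13y : s13 K y = C (2⁻¹) * (-x + y) := by
    simp [s13, hx, hy, algebraMap_eq, smul_eq_C_mul]; ring
  have hC2' : (2 : MvPolynomial (Fin 2) K) * C (2⁻¹) = 1 := by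
    rw [← map_ofNat C 2, ← map_mul, mul_inv_cancel₀ h2, map_one]
  have hfix : ∀ φ : MvPolynomial (Fin 2) K →ₐ[K] MvPolynomial (Fin 2) K,
      φ (sig2 K) = sig2 K → φ (sig3 K) = sig3 K → φ A = A ∧ φ B = B := by
    intro φ h h'
    simp only [hA, hB, map_sum, map_mul, map_pow, AlgHom.commutes, h, h', and_self]
  obtain ⟨h12A, h12B⟩ := hfix (s12 K)
    (by simp only [hs2, map_mul, map_add, map_pow, map_neg, map_ofNat, h12x, h12y, neg_sq])
    (by simp only [hs3, map_mul, map_sub, map_pow, map_neg, map_ofNat, h12x, h12y, neg_sq])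
  obtain ⟨h13A, h13B⟩ := hfix (s13 K)
    (by
      simp only [hs2, map_mul, map_add, map_pow, map_neg, map_ofNat, h13x, h13y]
      linear_combination (-3 * (x ^ 2 + 3 * y ^ 2)) * (2 * C (2⁻¹) + 1) * hC2')
    (by
      simp only [hs3, map_mul, map_sub, map_pow, map_neg, map_ofNat, h13x, h13y]
      linear_combination (-2 * (x ^ 3 - 9 * x * y ^ 2)) *
        ((2 * C (2⁻¹)) ^ 2 + 2 * C (2⁻¹) + 1) * hC2')
  let D : Derivation K (MvPolynomial (Fin 2) K) (MvPolynomial (Fin 2) K) := pderiv 0 + pderiv 1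
  have hD : ∀ f, pderiv 0 f + pderiv 1 f = D f := fun _ => rfl
  have hDx : 6 * D x = 1 := by
    rw [← hC6, ← hD, hx]; simp [Derivation.leibniz, pderiv_X]
  have hDy : 6 * D y = 1 := by
    rw [← hC6, ← hD, hy]; simp [Derivation.leibniz, pderiv_X]
  have hD2 : D (2 : MvPolynomial (Fin 2) K) = 0 := by simpa using D.map_natCast 2
  have hD3 : D (3 : MvPolynomial (Fin 2) K) = 0 := by simpa using D.map_natCast 3
  have hD6 : D (6 : MvPolynomial (Fin 2) K) = 0 := by simpa using D.map_natCast 6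
  have hD9 : D (9 : MvPolynomial (Fin 2) K) = 0 := by simpa using D.map_natCast 9
  have hDs2 : D (sig2 K) = -(x + 3 * y) := by
    rw [hs2]
    simp only [Derivation.leibniz, Derivation.leibniz_pow, map_add, map_neg, hD3, smul_eq_mul,
      nsmul_eq_mul, Nat.cast_ofNat]
    linear_combination -x * hDx - 3 * y * hDy
  have hDs3 : D (sig3 K) = -(x ^ 2 - 3 * y ^ 2 - 6 * x * y) := by
    rw [hs3]
    simp only [Derivation.leibniz, Derivation.leibniz_pow, map_sub, map_neg, hD2, hD9,
      smul_eq_mul, nsmul_eq_mul, Nat.cast_ofNat]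
    linear_combination (-x ^ 2 + 3 * y ^ 2) * hDx + 6 * x * y * hDy
  obtain ⟨A₂, A₃, B₂, B₃, hDA, hDB, hA₂, hB₂, hEA, hEB⟩ := exists_formal_partials D N lam mu
    (sig2 K) (sig3 K) hlam0 hmu0 hlammu hmulam A B hA hB
  rw [hDs2, hDs3] at hDA hDB
  rw [hs2] at hA₂
  rw [hs2, hs3] at hEA hEB
  obtain ⟨h₁, h₂⟩ := dunkl_components_of_system x y (C (c : K)) N A A₂ A₃ B B₂ B₃ (D A) (D B)
    hc hDA hDB hA₂ hB₂ hEA hEB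
  rw [hbp, hbm] at hF hG
  have hDF : D F = D A * (6 * x) + A + (D B * (36 * (-x ^ 2 + 3 * y ^ 2))
      + B * (-12 * x + 36 * y)) := by
    rw [hF]
    simp only [Derivation.leibniz, Derivation.leibniz_pow, map_add, map_neg, hD3, hD6,
      smul_eq_mul, nsmul_eq_mul, Nat.cast_ofNat]
    linear_combination (A - 12 * x * B) * hDx + 36 * y * B * hDy
  have hDG : D G = D A * (18 * y) + 3 * A + (D B * (216 * x * y) + B * (36 * (x + y))) := by
    rw [hG]
    simp only [Derivation.leibniz, map_add, hD2, hD3, hD6, smul_eq_mul]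
    linear_combination (3 * A + 36 * x * B) * hDy + 36 * y * B * hDx
  have h12F : s12 K F = F := by
    simp only [hF, map_add, map_mul, map_pow, map_neg, map_ofNat, h12A, h12B, h12x, h12y]
    ring
  have h12G : s12 K G = -G := by
    simp only [hG, map_add, map_mul, map_ofNat, h12A, h12B, h12x, h12y]
    ring
  have h13F : s13 K F = A * (-3 * x - 9 * y) + B * (18 * (x ^ 2 - 6 * x * y - 3 * y ^ 2)) := by
    simp only [hF, map_add, map_mul, map_pow, map_neg, map_ofNat, h13A, h13B, h13x, h13y]
    linear_combination (3 * A * (-x - 3 * y) + 18 * B * (x ^ 2 - 6 * x * y - 3 * y ^ 2) *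
      (2 * C (2⁻¹) + 1)) * hC2'
  have h13G : s13 K G = A * (-9 * x + 9 * y) + B * (54 * (x ^ 2 + 2 * x * y - 3 * y ^ 2)) := by
    simp only [hG, map_add, map_mul, map_ofNat, h13A, h13B, h13x, h13y]
    linear_combination (9 * A * (-x + y) + 54 * B * (x ^ 2 + 2 * x * y - 3 * y ^ 2) *
      (2 * C (2⁻¹) + 1)) * hC2'
  rw [hD, hD, hDF, hDG, h12F, h12G, h13F, h13G, hbp, hbm, hF, hG]
  constructor
  · linear_combination h₁
  · linear_combination h₂

end
end
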